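/- arXiv:0705.2546 — 3 statements merged into one kernel-verified Lean document; each statement's English description precedes it below -/
import Mathlib

section
/- Let (Γ, S) be a right-angled Coxeter system with S finite. Then asdim Γ ≤ dim N(Γ) + 1, where N(Γ) is the nerve of the system and Γ carries the word metric with respect to S. -/
/-- `AsdimLE d n` : the asymptotic dimension of the space `X` with distance
function `d` is at most `n`: for every `r > 0` there are `n + 1` families of
`r`-disjoint, uniformly bounded subsets of `X` which together cover `X`. -/
def AsdimLE {X : Type*} (d : X → X → ℝ) (n : ℕ) : Prop :=
  ∀ r : ℝ, 0 < r → ∃ (𝒰 : Fin (n + 1) → Set (Set X)) (D : ℝ),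
    (∀ i, ∀ U ∈ 𝒰 i, ∀ V ∈ 𝒰 i, U ≠ V → ∀ x ∈ U, ∀ y ∈ V, r ≤ d x y) ∧
    (∀ i, ∀ U ∈ 𝒰 i, ∀ x ∈ U, ∀ y ∈ U, d x y ≤ D) ∧
    (∀ x : X, ∃ i, ∃ U ∈ 𝒰 i, x ∈ U)

/-- The asymptotic dimension of the space `X` with distance function `d`,
as an extended natural number: the least `n` with `AsdimLE d n` (`⊤` if none). -/
noncomputable def asDim {X : Type*} (d : X → X → ℝ) : ℕ∞ :=
  sInf {N : ℕ∞ | ∃ n : ℕ, N = (n : ℕ∞) ∧ AsdimLE d n}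

/-- The word norm of `g` with respect to the generating set `S`. -/
noncomputable def wordNorm {G : Type*} [Group G] (S : Set G) (g : G) : ℕ :=
  sInf {k : ℕ | ∃ l : List G, l.length = k ∧ (∀ x ∈ l, x ∈ S) ∧ l.prod = g}

/-- The word metric on `G` associated with the generating set `S`. -/
noncomputable def wordDist {G : Type*} [Group G] (S : Set G) (g h : G) : ℝ :=
  (wordNorm S (g⁻¹ * h) : ℝ)

open Relation

namespace RACG

section Col

variable {S : Type*} {M : CoxeterMatrix S} {W : Type*} [Group W] (cs : CoxeterSystem M W)

/-- Word distance with natural number values. -/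
noncomputable def cd (x y : W) : ℕ := cs.length (x⁻¹ * y)

lemma cd_self (x : W) : cd cs x x = 0 := by simp [cd]

lemma cd_comm (x y : W) : cd cs x y = cd cs y x := by
  unfold cd
  rw [← cs.length_inv]
  simp

lemma cd_tri (x y z : W) : cd cs x z ≤ cd cs x y + cd cs y z := by
  unfold cd
  have := cs.length_mul_le (x⁻¹ * y) (y⁻¹ * z)
  simpa [mul_assoc] using this

lemma cd_mul (g x y : W) : cd cs (g * x) (g * y) = cd cs x y := by
  simp [cd, mul_assoc]

lemma cd_word (x : W) (l : List S) : cd cs x (x * cs.wordProd l) ≤ l.length := by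
  simpa [cd] using cs.length_wordProd_le l

lemma exists_word (x y : W) : ∃ l : List S, l.length = cd cs x y ∧ y = x * cs.wordProd l := by
  obtain ⟨l, h1, h2⟩ := cs.exists_isReduced (x⁻¹ * y)
  refine ⟨l, ?_, ?_⟩
  · unfold cd; rw [h2]; exact h1.symm
  · rw [← h2]; simp

/-- One monochromatic `r`-step inside `X`. -/
def Stp {n : ℕ} (c : W → Fin n) (X : Set W) (r : ℕ) (a b : W) : Prop :=
  a ∈ X ∧ b ∈ X ∧ c a = c b ∧ cd cs a b ≤ r

/-- `X` can, at each scale, be coloured with `n` colours so that the monochromatic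
chain components are uniformly bounded. -/
def HasCol (X : Set W) (n : ℕ) : Prop :=
  ∀ r : ℕ, ∃ D : ℕ, ∃ c : W → Fin n, ∀ x y, ReflTransGen (Stp cs c X r) x y → cd cs x y ≤ D

lemma HasCol.mono {X Y : Set W} {n : ℕ} (h : HasCol cs Y n) (hXY : X ⊆ Y) : HasCol cs X n := by
  intro r
  obtain ⟨D, c, hc⟩ := h r
  refine ⟨D, c, fun x y hxy => hc x y ?_⟩
  exact ReflTransGen.mono (fun a b h => ⟨hXY h.1, hXY h.2.1, h.2.2⟩) _ _ hxy

/-- Neighbourhood of a set. -/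
def nbd (X : Set W) (R : ℕ) : Set W := {x | ∃ y ∈ X, cd cs x y ≤ R}

lemma HasCol.nbd {X : Set W} {n : ℕ} (h : HasCol cs X n) (R : ℕ) : HasCol cs (nbd cs X R) n := by
  classical
  intro r
  obtain ⟨D, c, hc⟩ := h (r + 2 * R)
  have : ∀ x, ∃ y, x ∈ RACG.nbd cs X R → y ∈ X ∧ cd cs x y ≤ R := by
    intro x
    by_cases hx : x ∈ RACG.nbd cs X R
    · obtain ⟨y, hy⟩ := hx
      exact ⟨y, fun _ => hy⟩
    · exact ⟨x, fun h => absurd h hx⟩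
  choose f hf using this
  refine ⟨D + 2 * R, fun x => c (f x), fun x y hxy => ?_⟩
  rcases eq_or_ne x y with rfl | hne
  · simp [cd_self]
  have h1 : ReflTransGen (Stp cs c X (r + 2 * R)) (f x) (f y) := by
    refine hxy.lift f ?_
    rintro a b ⟨ha, hb, hcab, hd⟩
    refine ⟨(hf a ha).1, (hf b hb).1, hcab, ?_⟩
    have e1 := cd_tri cs (f a) a (f b)
    have e2 := cd_tri cs a b (f b)
    have e3 := (hf a ha).2
    have e4 := (hf b hb).2
    rw [cd_comm] at e3
    omega
  have hx : x ∈ RACG.nbd cs X R := by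
    rcases hxy.cases_head with h | ⟨z, hz, _⟩
    · exact absurd h hne
    · exact hz.1
  have hy : y ∈ RACG.nbd cs X R := by
    rcases hxy.cases_tail with h | ⟨z, _, hz⟩
    · exact absurd h hne.symm
    · exact hz.2.1
  have e0 := hc _ _ h1
  have e1 := cd_tri cs x (f x) y
  have e2 := cd_tri cs (f x) (f y) y
  have e3 := (hf x hx).2
  have e4 := (hf y hy).2
  rw [cd_comm] at e4
  omega

/-- Monochromatic step with equal keys. -/
def KStp {n : ℕ} {κ : Type*} (key : W → κ) (c : W → Fin n) (X : Set W) (r : ℕ) (a b : W) : Prop :=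
  Stp cs c X r a b ∧ key a = key b

lemma HasCol.family {X : Set W} {n : ℕ} (h : HasCol cs X n) {κ : Type*} (key : W → κ)
    (Z : Set W) (hZ : ∀ k, ∃ g : W, ∀ x ∈ Z, key x = k → g⁻¹ * x ∈ X) (r : ℕ) :
    ∃ D : ℕ, ∃ c : W → Fin n, ∀ x y, ReflTransGen (KStp cs key c Z r) x y → cd cs x y ≤ D := by
  obtain ⟨D, c, hc⟩ := h r
  choose g hg using hZ
  refine ⟨D, fun x => c ((g (key x))⁻¹ * x), fun x y hxy => ?_⟩
  have : key x = key y ∧ ReflTransGen (Stp cs c X r) ((g (key x))⁻¹ * x) ((g (key x))⁻¹ * y) := by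
    induction hxy with
    | refl => exact ⟨rfl, .refl⟩
    | tail _ hbc ih =>
      obtain ⟨⟨hb, hc', hcol, hd⟩, hk⟩ := hbc
      obtain ⟨ih1, ih2⟩ := ih
      refine ⟨ih1.trans hk, ih2.tail ⟨?_, ?_, ?_, ?_⟩⟩
      · exact hg _ _ hb ih1.symm
      · exact hg _ _ hc' (ih1.trans hk).symm
      · simpa only [← ih1, ← hk] using hcol
      · rwa [cd_mul]
  have h2 := hc _ _ this.2
  rwa [cd_mul] at h2

/-- Overlaying a coarse colouring on `Z` over a fine colouring on `Y`. -/
lemma overlay {n : ℕ} {κ : Type*} (key : W → κ) (c c0 : W → Fin n) (Y Z : Set W) (r E D : ℕ)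
    (hc0 : ∀ x ∈ Y, c x = c0 x)
    (h0 : ∀ x y, ReflTransGen (Stp cs c0 Y r) x y → cd cs x y ≤ E)
    (h1 : ∀ x y, ReflTransGen (KStp cs key c Z (E + 2 * r)) x y → cd cs x y ≤ D)
    (hkey : ∀ x y, Stp cs c (Y ∪ Z) r x y → key x = key y) :
    ∀ x y, ReflTransGen (Stp cs c (Y ∪ Z) r) x y → cd cs x y ≤ 2 * E + 2 * r + D := by
  intro x y hxy
  have key_inv : (ReflTransGen (Stp cs c0 Y r) x y) ∨
      (∃ z0 z y0, cd cs x z0 ≤ E + r ∧ z ∈ Z ∧ ReflTransGen (KStp cs key c Z (E + 2 * r)) z0 z ∧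
        ((y0 = z ∧ y = z) ∨ (cd cs z y0 ≤ r ∧ y0 ∈ Y ∧ ReflTransGen (Stp cs c0 Y r) y0 y)) ∧
        key z = key y ∧ c z = c y) := by
    induction hxy with
    | refl => exact .inl .refl
    | @tail a b hxa hab ih =>
      have hk := hkey _ _ hab
      obtain ⟨ha, hb, hcol, hd⟩ := hab
      rcases ih with ih | ⟨z0, z, y0, i1, i2, i3, i4, i5, i6⟩
      · rcases hb with hb | hb
        · rcases ha with ha | ha
          · left
            exact ih.tail ⟨ha, hb, by rw [← hc0 _ ha, ← hc0 _ hb, hcol], hd⟩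
          · right
            refine ⟨a, a, b, ?_, ha, .refl, .inr ⟨hd, hb, .refl⟩, hk, hcol⟩
            have := h0 _ _ ih; omega
        · right
          refine ⟨b, b, b, ?_, hb, .refl, .inl ⟨rfl, rfl⟩, rfl, rfl⟩
          have := h0 _ _ ih
          have := cd_tri cs x a b
          omega
      · right
        rcases hb with hb | hb
        · rcases i4 with ⟨rfl, rfl⟩ | ⟨j1, j2, j3⟩
          · exact ⟨z0, a, b, i1, i2, i3, .inr ⟨hd, hb, .refl⟩, hk, hcol⟩
          · have ha' : a ∈ Y := by
              rcases j3.cases_tail with h | ⟨w, _, hw⟩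
              · rw [h]; exact j2
              · exact hw.2.1
            exact ⟨z0, z, y0, i1, i2, i3, .inr ⟨j1, j2, j3.tail
              ⟨ha', hb, by rw [← hc0 _ ha', ← hc0 _ hb, hcol], hd⟩⟩, i5.trans hk, i6.trans hcol⟩
        · refine ⟨z0, b, b, i1, hb, i3.tail ⟨⟨i2, hb, i6.trans hcol, ?_⟩, i5.trans hk⟩,
            .inl ⟨rfl, rfl⟩, rfl, rfl⟩
          rcases i4 with ⟨rfl, rfl⟩ | ⟨j1, j2, j3⟩
          · omega
          · have := h0 _ _ j3
            have := cd_tri cs z y0 b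
            have := cd_tri cs y0 a b
            omega
  rcases key_inv with h | ⟨z0, z, y0, i1, i2, i3, i4, i5, i6⟩
  · have := h0 _ _ h; omega
  · have e1 := h1 _ _ i3
    have e2 := cd_tri cs x z0 y
    have e3 := cd_tri cs z0 z y
    rcases i4 with ⟨rfl, rfl⟩ | ⟨j1, j2, j3⟩
    · rw [cd_self] at e3; omega
    · have := h0 _ _ j3
      have := cd_tri cs z y0 y
      omega

end Col
section Tree

variable {S : Type*} {M : CoxeterMatrix S} {W : Type*} [Group W] (cs : CoxeterSystem M W)

/-- The subgroup generated by the link of `v`. -/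
def lkS (v : S) : Subgroup W := Subgroup.closure (cs.simple '' {s | s ≠ v ∧ M v s = 2})

/-- Reduced words over the cosets of the link subgroup. -/
abbrev Lw (v : S) : Type _ := {l : List (W ⧸ lkS cs v) // l.IsChain (· ≠ ·)}

/-- The base letter. -/
def i0 (v : S) : W ⧸ lkS cs v := QuotientGroup.mk 1

lemma comm_of_two {v s : S} (h : M v s = 2) : Commute (cs.simple v) (cs.simple s) := by
  have h1 := cs.simple_mul_simple_pow v s
  rw [h, pow_two] at h1
  have h2 := eq_inv_of_mul_eq_one_left h1
  rw [mul_inv_rev, cs.inv_simple, cs.inv_simple] at h2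
  exact h2

/-- Letterwise translation. -/
def tr (v : S) : W →* Equiv.Perm (Lw cs v) where
  toFun g :=
    { toFun := fun l => ⟨l.1.map (g • ·), by
        rw [List.isChain_map]
        exact l.2.imp fun a b h => by simpa using h⟩
      invFun := fun l => ⟨l.1.map (g⁻¹ • ·), by
        rw [List.isChain_map]
        exact l.2.imp fun a b h => by simpa using h⟩
      left_inv := fun l => by ext1; simp [Function.comp_def]
      right_inv := fun l => by ext1; simp [Function.comp_def] }
  map_one' := by ext l; simp
  map_mul' g h := by
    refine Equiv.ext fun l => Subtype.ext ?_
    simp [mul_smul, Function.comp_def]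

lemma tr_val (v : S) (g : W) (l : Lw cs v) : (tr cs v g l).1 = l.1.map (g • ·) := rfl

open Classical in
/-- Toggle on lists. -/
noncomputable def tglL (v : S) : List (W ⧸ lkS cs v) → List (W ⧸ lkS cs v)
  | [] => [i0 cs v]
  | a :: t => if a = i0 cs v then t else i0 cs v :: a :: t

lemma tglL_chain (v : S) (l : List (W ⧸ lkS cs v)) (h : l.IsChain (· ≠ ·)) :
    (tglL cs v l).IsChain (· ≠ ·) := by
  cases l with
  | nil => simp [tglL]
  | cons a t =>
    by_cases ha : a = i0 cs v
    · simp only [tglL, ha, if_true]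
      exact h.tail
    · simp only [tglL, ha, if_false]
      exact List.isChain_cons_cons.2 ⟨Ne.symm ha, h⟩

lemma tglL_tglL (v : S) (l : List (W ⧸ lkS cs v)) (h : l.IsChain (· ≠ ·)) :
    tglL cs v (tglL cs v l) = l := by
  cases l with
  | nil => simp [tglL]
  | cons a t =>
    by_cases ha : a = i0 cs v
    · cases t with
      | nil => simp [tglL, ha]
      | cons b t =>
        have hab := (List.isChain_cons_cons.1 h).1
        rw [ha] at hab
        simp [tglL, ha, hab.symm]
    · simp [tglL, ha]

/-- Toggle as a permutation. -/
noncomputable def tgl (v : S) : Equiv.Perm (Lw cs v) where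
  toFun l := ⟨tglL cs v l.1, tglL_chain cs v _ l.2⟩
  invFun l := ⟨tglL cs v l.1, tglL_chain cs v _ l.2⟩
  left_inv l := Subtype.ext (tglL_tglL cs v _ l.2)
  right_inv l := Subtype.ext (tglL_tglL cs v _ l.2)

lemma tgl_val (v : S) (l : Lw cs v) : (tgl cs v l).1 = tglL cs v l.1 := rfl

lemma smul_i0 (v : S) {g : W} : g • i0 cs v = i0 cs v ↔ g ∈ lkS cs v := by
  unfold i0
  rw [MulAction.Quotient.smul_mk, eq_comm, QuotientGroup.eq]
  simp

lemma tgl_tr (v : S) {g : W} (hg : g ∈ lkS cs v) : Commute (tgl cs v) (tr cs v g) := by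
  refine Equiv.ext fun l => Subtype.ext ?_
  have h0 := (smul_i0 cs v).2 hg
  simp only [Equiv.Perm.coe_mul, Function.comp_apply, tgl_val, tr_val]
  rcases l with ⟨l, hl⟩
  cases l with
  | nil => simp [tglL, h0]
  | cons a t =>
    have : g • a = i0 cs v ↔ a = i0 cs v := by
      constructor
      · intro h
        rw [← h0] at h
        exact MulAction.injective g h
      · rintro rfl; exact h0
    by_cases ha : a = i0 cs v
    · simp [tglL, ha, h0]
    · simp [tglL, ha, this, h0]

open Classical in
/-- Generators acting. -/
noncomputable def gen (v s : S) : Equiv.Perm (Lw cs v) :=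
  if s = v then tgl cs v else tr cs v (cs.simple s)

lemma tgl_sq (v : S) : tgl cs v * tgl cs v = 1 := by
  refine Equiv.ext fun l => Subtype.ext ?_
  exact tglL_tglL cs v _ l.2

lemma mem_lkS {v s : S} (h : s ≠ v) (h2 : M v s = 2) : cs.simple s ∈ lkS cs v :=
  Subgroup.subset_closure ⟨s, ⟨h, h2⟩, rfl⟩

variable (hra : ∀ s t : S, s ≠ t → M s t = 2 ∨ M s t = 0)

lemma gen_liftable (hra : ∀ s t : S, s ≠ t → M s t = 2 ∨ M s t = 0) (v : S) : M.IsLiftable (gen cs v) := by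
  intro i j
  have aux : ∀ s, s ≠ v → M v s = 2 → (tgl cs v * tr cs v (cs.simple s)) ^ 2 = 1 := by
    intro s hs h2
    rw [(tgl_tr cs v (mem_lkS cs hs h2)).mul_pow, ← map_pow, cs.simple_sq, pow_two, tgl_sq]
    simp
  by_cases hi : i = v <;> by_cases hj : j = v
  · subst hi; subst hj
    simp [gen, tgl_sq]
  · subst hi
    rcases hra i j (Ne.symm hj) with h | h
    · simp only [gen, hj, if_true, if_false, h]
      exact aux j hj h
    · simp [h]
  · subst hj
    rcases hra i j hi with h | h
    · simp only [gen, hi, if_true, if_false, h]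
      have h' : M j i = 2 := by rw [M.symmetric]; exact h
      rw [← (tgl_tr cs j (mem_lkS cs hi h')).eq]
      exact aux i hi h'
    · simp [h]
  · simp only [gen, hi, hj, if_false]
    rw [← map_mul, ← map_pow, cs.simple_mul_simple_pow, map_one]

/-- The action on reduced words. -/
noncomputable def act (v : S) : W →* Equiv.Perm (Lw cs v) :=
  cs.lift ⟨gen cs v, gen_liftable cs hra v⟩

lemma act_v (v : S) (l : Lw cs v) : (act cs hra v (cs.simple v) l).1 = tglL cs v l.1 := by
  rw [act, cs.lift_apply_simple, gen, if_pos rfl, tgl_val]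

lemma act_s (v : S) {s : S} (h : s ≠ v) (l : Lw cs v) :
    (act cs hra v (cs.simple s) l).1 = l.1.map (cs.simple s • ·) := by
  rw [act, cs.lift_apply_simple, gen, if_neg h, tr_val]

/-- Adjacency in the tree. -/
def LAdj {α : Type*} (l l' : List α) : Prop := ∃ i, l' = l ++ [i] ∨ l = l' ++ [i]

lemma tglL_adj (v : S) (l : List (W ⧸ lkS cs v)) (i : W ⧸ lkS cs v) :
    LAdj (tglL cs v l) (tglL cs v (l ++ [i])) := by
  cases l with
  | nil =>
    by_cases hi : i = i0 cs v
    · exact ⟨i0 cs v, .inr (by simp [tglL, hi])⟩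
    · exact ⟨i, .inl (by simp [tglL, hi])⟩
  | cons a t =>
    refine ⟨i, .inl ?_⟩
    by_cases ha : a = i0 cs v <;> simp [tglL, ha]

lemma LAdj.symm {α : Type*} {l l' : List α} (h : LAdj l l') : LAdj l' l := by
  obtain ⟨i, h⟩ := h
  exact ⟨i, h.symm⟩

lemma act_adj (v : S) (x : W) : ∀ l l' : Lw cs v, LAdj l.1 l'.1 →
    LAdj (act cs hra v x l).1 (act cs hra v x l').1 := by
  induction x using cs.simple_induction_left with
  | one => intro l l' h; simpa using h
  | mul_simple_left x s ih =>
    intro l l' h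
    rw [map_mul, Equiv.Perm.mul_apply, Equiv.Perm.mul_apply]
    have := ih _ _ h
    generalize act cs hra v x l = m at this
    generalize act cs hra v x l' = m' at this
    by_cases hs : s = v
    · subst hs
      rw [act_v, act_v]
      obtain ⟨i, h | h⟩ := this
      · rw [h]; exact tglL_adj _ _ _ _
      · rw [h]; exact (tglL_adj _ _ _ _).symm
    · rw [act_s _ _ _ hs, act_s _ _ _ hs]
      obtain ⟨i, h | h⟩ := this
      · rw [h]; exact ⟨cs.simple s • i, .inl (by simp)⟩
      · rw [h]; exact ⟨cs.simple s • i, .inr (by simp)⟩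

/-- The empty word. -/
def nilw (v : S) : Lw cs v := ⟨[], by simp⟩

/-- The piece containing `x`. -/
noncomputable def pc (v : S) (x : W) : List (W ⧸ lkS cs v) := (act cs hra v x (nilw cs v)).1

lemma pc_one (v : S) : pc cs hra v 1 = [] := by simp [pc, nilw]

lemma pc_mul_s (v : S) {s : S} (h : s ≠ v) (x : W) :
    pc cs hra v (x * cs.simple s) = pc cs hra v x := by
  unfold pc
  rw [map_mul, Equiv.Perm.mul_apply]
  congr 2
  apply Subtype.ext
  rw [act_s _ _ _ h]
  simp [nilw]

lemma pc_mul_v (v : S) (x : W) : LAdj (pc cs hra v x) (pc cs hra v (x * cs.simple v)) := by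
  unfold pc
  rw [map_mul, Equiv.Perm.mul_apply]
  apply act_adj
  rw [act_v]
  exact ⟨i0 cs v, .inl (by simp [nilw, tglL])⟩

lemma pc_step (v : S) (x : W) (s : S) :
    pc cs hra v (x * cs.simple s) = pc cs hra v x ∨
      (s = v ∧ LAdj (pc cs hra v x) (pc cs hra v (x * cs.simple s))) := by
  by_cases h : s = v
  · subst h; exact .inr ⟨rfl, pc_mul_v _ _ _ _⟩
  · exact .inl (pc_mul_s _ _ _ h _)

lemma LAdj.len {α : Type*} {l l' : List α} (h : LAdj l l') :
    l.length ≤ l'.length + 1 ∧ l'.length ≤ l.length + 1 := by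
  obtain ⟨i, h | h⟩ := h <;> subst h <;> simp <;> omega

lemma LAdj.take {α : Type*} {l l' : List α} (h : LAdj l l') {q : ℕ} (h1 : q ≤ l.length)
    (h2 : q ≤ l'.length) : l.take q = l'.take q := by
  obtain ⟨i, h | h⟩ := h <;> subst h
  · rw [List.take_append_of_le_length h1]
  · rw [List.take_append_of_le_length h2]

lemma pc_len_word (v : S) (l : List S) : ∀ x : W,
    (pc cs hra v x).length ≤ (pc cs hra v (x * cs.wordProd l)).length + l.length ∧
    (pc cs hra v (x * cs.wordProd l)).length ≤ (pc cs hra v x).length + l.length := by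
  induction l with
  | nil => intro x; simp
  | cons s l ih =>
    intro x
    rw [cs.wordProd_cons, ← mul_assoc]
    have := ih (x * cs.simple s)
    rcases pc_step cs hra v x s with h | ⟨_, h⟩
    · rw [h] at this; simp only [List.length_cons]; omega
    · have := h.len; simp only [List.length_cons]; omega

lemma pc_lip (v : S) (x y : W) :
    (pc cs hra v x).length ≤ (pc cs hra v y).length + cd cs x y := by
  obtain ⟨l, h1, rfl⟩ := exists_word cs x y
  rw [← h1]
  exact (pc_len_word cs hra v l x).1

lemma pc_take_word (v : S) (q : ℕ) (l : List S) : ∀ x : W,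
    (∀ z, cd cs x z ≤ l.length → q ≤ (pc cs hra v z).length) →
    (pc cs hra v x).take q = (pc cs hra v (x * cs.wordProd l)).take q := by
  induction l using List.reverseRecOn with
  | nil => intro x _; simp
  | append_singleton l s ih =>
    intro x hx
    have h1 := ih x (fun z hz => hx z (hz.trans (by simp)))
    rw [h1, cs.wordProd_append, ← mul_assoc, cs.wordProd_singleton]
    rcases pc_step cs hra v (x * cs.wordProd l) s with h | ⟨_, h⟩
    · rw [h]
    · apply h.take
      · apply hx
        exact (cd_word cs x l).trans (by simp)
      · apply hx
        have := cd_word cs x (l ++ [s])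
        rwa [cs.wordProd_append, ← mul_assoc, cs.wordProd_singleton] at this

lemma pc_take (v : S) (q : ℕ) (x y : W)
    (h : ∀ z, cd cs x z ≤ cd cs x y → q ≤ (pc cs hra v z).length) :
    (pc cs hra v x).take q = (pc cs hra v y).take q := by
  obtain ⟨l, h1, rfl⟩ := exists_word cs x y
  rw [← h1] at h
  exact pc_take_word cs hra v q l x h

lemma exists_pc (v : S) (n : ℕ) (x : W) :
    ∃ g, pc cs hra v g = (pc cs hra v x).take n := by
  induction x using cs.simple_induction_right with
  | one => exact ⟨1, by simp [pc_one]⟩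
  | mul_simple_right x s ih =>
    obtain ⟨g, hg⟩ := ih
    rcases pc_step cs hra v x s with h | ⟨_, h⟩
    · exact ⟨g, by rw [h, hg]⟩
    · by_cases hn : (pc cs hra v (x * cs.simple s)).length ≤ n
      · exact ⟨x * cs.simple s, by rw [List.take_of_length_le hn]⟩
      · push Not at hn
        refine ⟨g, ?_⟩
        rw [hg]
        apply h.take _ hn.le
        have := h.len
        omega

lemma wall_word (v : S) (n : ℕ) (l : List S) : ∀ x : W, n ≤ (pc cs hra v x).length →
    (pc cs hra v (x * cs.wordProd l)).length < n →
    ∃ y, cd cs x y ≤ l.length ∧ (pc cs hra v y).length < n ∧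
      pc cs hra v (y * cs.simple v) = (pc cs hra v x).take n := by
  induction l with
  | nil => intro x h1 h2; simp at h2; omega
  | cons s l ih =>
    intro x h1 h2
    rw [cs.wordProd_cons, ← mul_assoc] at h2
    have hxs : cd cs x (x * cs.simple s) ≤ 1 := by simpa using cd_word cs x [s]
    by_cases h3 : n ≤ (pc cs hra v (x * cs.simple s)).length
    · obtain ⟨y, hy1, hy2, hy3⟩ := ih _ h3 h2
      refine ⟨y, ?_, hy2, ?_⟩
      · have := cd_tri cs x (x * cs.simple s) y
        simp only [List.length_cons]; omega
      · rw [hy3]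
        rcases pc_step cs hra v x s with h | ⟨_, h⟩
        · rw [h]
        · exact (h.take h1 h3).symm
    · rcases pc_step cs hra v x s with h | ⟨rfl, h⟩
      · rw [h] at h3; omega
      · refine ⟨x * cs.simple s, ?_, by omega, ?_⟩
        · simp only [List.length_cons]; omega
        · rw [cs.simple_mul_simple_cancel_right, List.take_of_length_le]
          have := h.len
          omega

/-- Kill `v`. -/
lemma kill_liftable (hra : ∀ s t : S, s ≠ t → M s t = 2 ∨ M s t = 0) (v : S) [DecidableEq S] :
    M.IsLiftable (fun s => if s = v then (1 : W) else cs.simple s) := by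
  intro i j
  by_cases hi : i = v <;> by_cases hj : j = v
  · simp [hi, hj]
  · rcases hra i j (by rw [hi]; exact Ne.symm hj) with h | h <;> simp [hi, hj] <;> simp [← hi, h]
  · rcases hra i j (by rw [hj]; exact hi) with h | h <;> simp [hi, hj] <;> simp [← hj, h]
  · simp [hi, hj]

open Classical in
/-- The retraction killing `v`. -/
noncomputable def kill (v : S) : W →* W := cs.lift ⟨_, kill_liftable cs hra v⟩

lemma kill_v (v : S) : kill cs hra v (cs.simple v) = 1 := by
  rw [kill, cs.lift_apply_simple, if_pos rfl]

lemma kill_s (v : S) {s : S} (h : s ≠ v) : kill cs hra v (cs.simple s) = cs.simple s := by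
  rw [kill, cs.lift_apply_simple, if_neg h]

lemma lkS_comm (v : S) {g : W} (hg : g ∈ lkS cs v) : Commute (cs.simple v) g := by
  have : lkS cs v ≤ Subgroup.centralizer {cs.simple v} := by
    rw [lkS, Subgroup.closure_le]
    rintro _ ⟨s, ⟨_, h⟩, rfl⟩
    rw [SetLike.mem_coe, Subgroup.mem_centralizer_singleton_iff]
    exact (comm_of_two cs h).eq.symm
  have := this hg
  rw [Subgroup.mem_centralizer_singleton_iff] at this
  exact this.symm

/-- Evaluate a letter. -/
noncomputable def evL (v : S) : W ⧸ lkS cs v → W :=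
  Quotient.lift (fun g => g * cs.simple v * g⁻¹) (by
    intro a b hab
    have h : a⁻¹ * b ∈ lkS cs v := QuotientGroup.leftRel_apply.1 hab
    have h2 := (lkS_comm cs v h).eq
    show a * cs.simple v * a⁻¹ = b * cs.simple v * b⁻¹
    have : b = a * (a⁻¹ * b) := by group
    rw [this]
    generalize a⁻¹ * b = c at h2
    rw [mul_inv_rev, mul_assoc a c, ← h2]
    group)

lemma evL_smul (v : S) (g : W) (i : W ⧸ lkS cs v) : evL cs v (g • i) = g * evL cs v i * g⁻¹ := by
  induction i using QuotientGroup.induction_on with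
  | H z =>
    show (g * z) * cs.simple v * (g * z)⁻¹ = g * (z * cs.simple v * z⁻¹) * g⁻¹
    group

lemma evL_i0 (v : S) : evL cs v (i0 cs v) = cs.simple v := by
  show (1 : W) * cs.simple v * 1⁻¹ = _
  simp

/-- Evaluate a list. -/
noncomputable def ev (v : S) (l : List (W ⧸ lkS cs v)) : W := (l.map (evL cs v)).prod

lemma ev_smul (v : S) (g : W) (l : List (W ⧸ lkS cs v)) :
    ev cs v (l.map (g • ·)) = g * ev cs v l * g⁻¹ := by
  induction l with
  | nil => simp [ev]
  | cons a t ih =>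
    simp only [ev, List.map_cons, List.prod_cons] at ih ⊢
    rw [ih, evL_smul]
    group

lemma ev_tgl (v : S) (l : List (W ⧸ lkS cs v)) : ev cs v (tglL cs v l) = cs.simple v * ev cs v l := by
  cases l with
  | nil => simp [ev, tglL, evL_i0]
  | cons a t =>
    by_cases ha : a = i0 cs v <;> simp [ev, tglL, evL_i0, ha]

lemma eq_ev_mul_kill (v : S) (x : W) : x = ev cs v (pc cs hra v x) * kill cs hra v x := by
  induction x using cs.simple_induction_left with
  | one => simp [pc_one, ev]
  | mul_simple_left x s ih =>
    have h1 : pc cs hra v (cs.simple s * x) =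
      (act cs hra v (cs.simple s) (act cs hra v x (nilw cs v))).1 := by
      rw [pc, map_mul, Equiv.Perm.mul_apply]
    by_cases hs : s = v
    · subst hs
      rw [h1, act_v, ev_tgl, map_mul, kill_v, one_mul, mul_assoc]
      congr 1
    · rw [h1, act_s _ _ _ hs, ev_smul, map_mul, kill_s _ _ _ hs]
      have : cs.simple s * ev cs v (pc cs hra v x) * (cs.simple s)⁻¹ *
        (cs.simple s * kill cs hra v x) = cs.simple s * (ev cs v (pc cs hra v x) * kill cs hra v x) := by
        group
      rw [← ih] at this
      exact this.symm

/-- The subgroup generated by everything but `v`. -/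
def coS (v : S) : Subgroup W := Subgroup.closure (cs.simple '' {s | s ≠ v})

lemma kill_mem (v : S) (x : W) : kill cs hra v x ∈ coS cs v := by
  induction x using cs.simple_induction_left with
  | one => rw [map_one]; exact one_mem _
  | mul_simple_left x s ih =>
    rw [map_mul]
    by_cases hs : s = v
    · subst hs; rw [kill_v, one_mul]; exact ih
    · rw [kill_s _ _ _ hs]
      exact mul_mem (Subgroup.subset_closure ⟨s, hs, rfl⟩) ih

lemma mem_coS_of_pc (v : S) {x : W} (h : pc cs hra v x = []) : x ∈ coS cs v := by
  have h1 := eq_ev_mul_kill cs hra v x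
  rw [h] at h1
  rw [h1]
  simpa [ev] using kill_mem cs hra v x

lemma act_coS (v : S) {x : W} (h : x ∈ coS cs v) :
    act cs hra v x = tr cs v x := by
  have : coS cs v ≤ (act cs hra v).eqLocus (tr cs v) := by
    rw [coS, Subgroup.closure_le]
    rintro _ ⟨s, hs, rfl⟩
    show act cs hra v _ = tr cs v _
    refine Equiv.ext fun l => Subtype.ext ?_
    rw [act_s _ _ _ hs, tr_val]
  exact this h

lemma pc_mul (v : S) (g x : W) :
    pc cs hra v (g * x) = (act cs hra v g ⟨pc cs hra v x, (act cs hra v x (nilw cs v)).2⟩).1 := by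
  unfold pc
  rw [map_mul, Equiv.Perm.mul_apply]

lemma pc_mul_nil (v : S) {g x : W} (h : pc cs hra v g = pc cs hra v x) :
    pc cs hra v (g⁻¹ * x) = [] := by
  have h2 := pc_mul cs hra v g⁻¹ g
  have h3 := pc_mul cs hra v g⁻¹ x
  simp only [h] at h2
  rw [h3, ← h2]
  simp [pc_one]

lemma wall_unique (v : S) {y y' : W} (h1 : pc cs hra v y = pc cs hra v y')
    (h2 : pc cs hra v (y * cs.simple v) = pc cs hra v (y' * cs.simple v)) :
    y⁻¹ * y' ∈ lkS cs v := by
  have ha := mem_coS_of_pc cs hra v (pc_mul_nil cs hra v h1)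
  have e1 := pc_mul cs hra v y⁻¹ (y * cs.simple v)
  have e2 := pc_mul cs hra v y⁻¹ (y' * cs.simple v)
  simp only [h2] at e1
  rw [← e1, ← mul_assoc, ← mul_assoc, inv_mul_cancel, one_mul] at e2
  rw [pc_mul, act_coS cs hra v ha, tr_val] at e2
  have e3 : pc cs hra v (cs.simple v) = [i0 cs v] := by
    rw [pc, act_v]; simp [nilw, tglL]
  simp only [e3] at e2
  simp only [List.map_cons, List.map_nil, List.cons.injEq, and_true] at e2
  exact (smul_i0 cs v).1 e2

lemma act_len (v : S) (g : W) (m : List (W ⧸ lkS cs v)) : ∀ (u : List (W ⧸ lkS cs v))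
    (hu : u.IsChain (· ≠ ·)) (hum : (u ++ m).IsChain (· ≠ ·)),
    (act cs hra v g ⟨u ++ m, hum⟩).1.length ≤ (act cs hra v g ⟨u, hu⟩).1.length + m.length := by
  induction m using List.reverseRecOn with
  | nil => intro u hu hum; simp
  | append_singleton m i ih =>
    intro u hu hum
    have hum' : (u ++ m).IsChain (· ≠ ·) := by
      rw [← List.append_assoc] at hum
      exact hum.left_of_append
    have h1 := ih u hu hum'
    have h2 := (act_adj cs hra v g ⟨u ++ m, hum'⟩ ⟨u ++ (m ++ [i]), hum⟩
      ⟨i, .inl (by simp)⟩).len.2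
    simp only [List.length_append, List.length_singleton]
    omega

lemma pc_mul_len (v : S) {g x : W} {n : ℕ} (h : pc cs hra v g = (pc cs hra v x).take n) :
    (pc cs hra v (g⁻¹ * x)).length ≤ (pc cs hra v x).length - n := by
  have hx : (pc cs hra v x).IsChain (· ≠ ·) := (act cs hra v x (nilw cs v)).2
  have hg : (pc cs hra v g).IsChain (· ≠ ·) := (act cs hra v g (nilw cs v)).2
  have h1 : pc cs hra v g ++ (pc cs hra v x).drop n = pc cs hra v x := by
    rw [h, List.take_append_drop]
  have h2 := act_len cs hra v g⁻¹ ((pc cs hra v x).drop n) (pc cs hra v g) hg (by rw [h1]; exact hx)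
  rw [List.length_drop] at h2
  simp only [h1] at h2
  have h3 := pc_mul cs hra v g⁻¹ g
  rw [inv_mul_cancel, pc_one] at h3
  rw [← h3] at h2
  rw [pc_mul]
  simpa using h2

end Tree
section Main

variable {S : Type*} {M : CoxeterMatrix S} {W : Type*} [Group W] (cs : CoxeterSystem M W)
variable (hra : ∀ s t : S, s ≠ t → M s t = 2 ∨ M s t = 0)

lemma ball_col (v : S) {n : ℕ} (hA : HasCol cs (coS cs v : Set W) n) (k : ℕ) :
    HasCol cs {x | (pc cs hra v x).length ≤ k} n := by
  classical
  induction k with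
  | zero =>
    refine hA.mono cs fun x hx => mem_coS_of_pc cs hra v ?_
    exact List.length_eq_zero_iff.1 (Nat.le_zero.1 hx)
  | succ k ih =>
    intro r
    set B : Set W := {x | (pc cs hra v x).length ≤ k} with hB
    obtain ⟨E, c0, hc0⟩ := hA.family cs (pc cs hra v) Set.univ (by
      intro u
      by_cases hu : ∃ g, pc cs hra v g = u
      · obtain ⟨g, rfl⟩ := hu
        exact ⟨g, fun x _ hx => mem_coS_of_pc cs hra v (pc_mul_nil cs hra v hx.symm)⟩
      · exact ⟨1, fun x _ hx => absurd ⟨x, hx⟩ hu⟩) r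
    obtain ⟨D, c1, hc1⟩ := ih.nbd cs r (E + 2 * r)
    set Z := nbd cs B r with hZ
    set Y : Set W := {x | (pc cs hra v x).length = k + 1 ∧ x ∉ Z} with hY
    refine ⟨2 * E + 2 * r + D, fun x => if x ∈ Z then c1 x else c0 x, fun x y hxy => ?_⟩
    refine overlay cs (fun _ => ()) (fun x => if x ∈ Z then c1 x else c0 x) c0 Y Z r E D
      ?_ ?_ ?_ ?_ x y ?_
    · intro x hx
      simp [hx.2]
    · intro x y hxy
      refine hc0 x y (ReflTransGen.mono ?_ _ _ hxy)
      rintro a b ⟨ha, hb, hcol, hd⟩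
      refine ⟨⟨trivial, trivial, hcol, hd⟩, ?_⟩
      have := pc_take cs hra v (k + 1) a b (by
        intro z hz
        by_contra hlt
        refine ha.2 ⟨z, ?_, hz.trans hd⟩
        show (pc cs hra v z).length ≤ k
        omega)
      rwa [List.take_of_length_le ha.1.le, List.take_of_length_le hb.1.le] at this
    · intro x y hxy
      refine hc1 x y (ReflTransGen.mono ?_ _ _ hxy)
      rintro a b ⟨⟨ha, hb, hcol, hd⟩, -⟩
      refine ⟨ha, hb, ?_, hd⟩
      simpa [ha, hb] using hcol
    · intros; rfl
    · refine ReflTransGen.mono ?_ _ _ hxy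
      have aux : ∀ a : W, a ∈ {x | (pc cs hra v x).length ≤ k + 1} → a ∈ Y ∪ Z := by
        intro a ha
        by_cases haz : a ∈ Z
        · exact .inr haz
        · refine .inl ⟨?_, haz⟩
          have h1 : (pc cs hra v a).length ≤ k + 1 := ha
          by_contra hne
          exact haz ⟨a, (by show (pc cs hra v a).length ≤ k; omega), by rw [cd_self]; omega⟩
      rintro a b ⟨ha, hb, hcol, hd⟩
      exact ⟨aux a ha, aux b hb, hcol, hd⟩

/-- Coarse level. -/
noncomputable def mm (v : S) (K : ℕ) (x : W) : ℕ := (pc cs hra v x).length / K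

/-- Closeness to the upper wall of the block. -/
def near (v : S) (K r t : ℕ) (x : W) : Prop :=
  ∃ z, (pc cs hra v z).length < mm cs hra v K x * K ∧ cd cs x z ≤ t * r

/-- Layer index in the block. -/
noncomputable def bb (v : S) (K r N : ℕ) (x : W) : ℕ :=
  sInf {t | t = N ∨ near cs hra v K r (t + 1) x}

/-- The total coordinate. -/
noncomputable def T1 (v : S) (K r N : ℕ) (x : W) : ℕ := mm cs hra v K x * N + bb cs hra v K r N x

lemma bb_le_of_near (v : S) {K r N t : ℕ} {x : W} (h : near cs hra v K r (t + 1) x) :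
    bb cs hra v K r N x ≤ t := Nat.sInf_le (.inr h)

lemma bb_le (v : S) (K r N : ℕ) (x : W) : bb cs hra v K r N x ≤ N := Nat.sInf_le (.inl rfl)

lemma bb_spec (v : S) (K r N : ℕ) (x : W) :
    bb cs hra v K r N x = N ∨ near cs hra v K r (bb cs hra v K r N x + 1) x :=
  Nat.sInf_mem (s := {t | t = N ∨ near cs hra v K r (t + 1) x}) ⟨N, .inl rfl⟩

lemma bb_step (v : S) {K r N : ℕ} {x y : W} (hm : mm cs hra v K x = mm cs hra v K y)
    (hd : cd cs x y ≤ r) : bb cs hra v K r N y ≤ bb cs hra v K r N x + 1 := by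
  rcases bb_spec cs hra v K r N x with h | ⟨z, h1, h2⟩
  · have := bb_le cs hra v K r N y
    omega
  · apply bb_le_of_near
    refine ⟨z, by rwa [← hm], ?_⟩
    have h3 := cd_tri cs y x z
    rw [cd_comm cs y x] at h3
    rw [add_mul _ 1 r]
    omega

lemma mm_le (v : S) (K : ℕ) (x : W) : mm cs hra v K x * K ≤ (pc cs hra v x).length :=
  Nat.div_mul_le_self _ _

lemma lt_mm (v : S) {K : ℕ} (hK : 0 < K) (x : W) :
    (pc cs hra v x).length < mm cs hra v K x * K + K := by
  have := Nat.lt_div_mul_add (a := (pc cs hra v x).length) hK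
  exact this

lemma T1_ge (v : S) (K r N : ℕ) (x : W) : N ≤ T1 cs hra v K r N x := by
  unfold T1
  rcases Nat.eq_zero_or_pos (mm cs hra v K x) with h | h
  · rcases bb_spec cs hra v K r N x with h1 | ⟨z, h1, h2⟩
    · omega
    · rw [h] at h1; omega
  · nlinarith

lemma nbr_aux (v : S) {K r d : ℕ} (hr : 0 < r) (hK : K = (d + 3) * r) {x y : W}
    (hd : cd cs x y ≤ r) (hm : mm cs hra v K x ≤ mm cs hra v K y) :
    (T1 cs hra v K r (d + 2) x ≤ T1 cs hra v K r (d + 2) y + 1 ∧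
     T1 cs hra v K r (d + 2) y ≤ T1 cs hra v K r (d + 2) x + 1) ∧
    ∀ q, q ≤ (T1 cs hra v K r (d + 2) x - 1) / (d + 2) →
      q ≤ (T1 cs hra v K r (d + 2) y - 1) / (d + 2) →
      (pc cs hra v x).take (K * q) = (pc cs hra v y).take (K * q) := by
  have hK0 : 0 < K := by rw [hK]; positivity
  have hKr : K = (d + 2) * r + r := by rw [hK]; ring
  have hrK : r ≤ (d + 2) * r := Nat.le_mul_of_pos_left r (by omega)
  have lx := mm_le cs hra v K x
  have ly := mm_le cs hra v K y
  have ux := lt_mm cs hra v hK0 x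
  have uy := lt_mm cs hra v hK0 y
  have l1 := pc_lip cs hra v x y
  have l2 := pc_lip cs hra v y x
  rw [cd_comm cs y x] at l2
  have hbx := bb_le cs hra v K r (d + 2) x
  have hby := bb_le cs hra v K r (d + 2) y
  rcases Nat.lt_or_ge (mm cs hra v K x) (mm cs hra v K y) with hlt | hge
  · -- consecutive blocks
    have hmy : mm cs hra v K y = mm cs hra v K x + 1 := by
      by_contra hne
      have h2 : mm cs hra v K x + 2 ≤ mm cs hra v K y := by omega
      have h3 : (mm cs hra v K x + 2) * K ≤ mm cs hra v K y * K := Nat.mul_le_mul_right K h2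
      rw [add_mul] at h3
      omega
    have hmyK : mm cs hra v K y * K = mm cs hra v K x * K + K := by rw [hmy]; ring
    have hb_y : bb cs hra v K r (d + 2) y = 0 := by
      have := bb_le_of_near cs hra v (N := d + 2) (t := 0) (x := y) (K := K) (r := r)
        ⟨x, by omega, by rw [cd_comm]; omega⟩
      omega
    have hb_x : bb cs hra v K r (d + 2) x = d + 2 := by
      rcases bb_spec cs hra v K r (d + 2) x with h | ⟨z, h1, h2⟩
      · exact h
      · by_contra hne
        have h3 := pc_lip cs hra v x z
        have h4 : (bb cs hra v K r (d + 2) x + 1) * r ≤ (d + 2) * r :=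
          Nat.mul_le_mul_right r (by omega)
        omega
    have hTx : T1 cs hra v K r (d + 2) x = (mm cs hra v K x + 1) * (d + 2) := by
      unfold T1; rw [hb_x]; ring
    have hTy : T1 cs hra v K r (d + 2) y = (mm cs hra v K x + 1) * (d + 2) := by
      unfold T1; rw [hb_y, hmy]; ring
    refine ⟨by omega, ?_⟩
    intro q hq _
    have hq' : q ≤ mm cs hra v K x := by
      refine hq.trans ?_
      rw [hTx, ← Nat.lt_succ_iff, Nat.div_lt_iff_lt_mul (by omega)]
      have : 0 < (mm cs hra v K x + 1) * (d + 2) := by positivity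
      exact Nat.sub_lt this one_pos
    have hqK : K * q ≤ mm cs hra v K x * K := by
      rw [mul_comm]; exact Nat.mul_le_mul_right K hq'
    apply pc_take
    intro z hz
    have h3 := pc_lip cs hra v x z
    omega
  · have hmm : mm cs hra v K x = mm cs hra v K y := le_antisymm hm hge
    refine ⟨?_, ?_⟩
    · have h1 := bb_step cs hra v (r := r) (N := d + 2) hmm hd
      have h2 := bb_step cs hra v (r := r) (N := d + 2) hmm.symm (by rw [cd_comm]; exact hd)
      unfold T1
      rw [hmm]
      omega
    · intro q hq _
      apply pc_take
      by_contra hcon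
      push Not at hcon
      obtain ⟨z, hz1, hz2⟩ := hcon
      have hqm : q ≤ mm cs hra v K x := by
        refine hq.trans ?_
        rw [← Nat.lt_succ_iff, Nat.div_lt_iff_lt_mul (by omega)]
        unfold T1
        have : (mm cs hra v K x + 1) * (d + 2) = mm cs hra v K x * (d + 2) + (d + 2) := by ring
        rw [Nat.succ_eq_add_one, this]
        omega
      have hqK : K * q ≤ mm cs hra v K x * K := by
        rw [mul_comm]; exact Nat.mul_le_mul_right K hqm
      have hb0 : bb cs hra v K r (d + 2) x = 0 := by
        have := bb_le_of_near cs hra v (N := d + 2) (t := 0) (x := x) (K := K) (r := r)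
          ⟨z, by omega, by omega⟩
        omega
      have hge1 := T1_ge cs hra v K r (d + 2) x
      have hm1 : 1 ≤ mm cs hra v K x := by
        by_contra h0
        have h0 : mm cs hra v K x = 0 := by omega
        unfold T1 at hge1
        rw [h0, hb0] at hge1
        omega
      obtain ⟨m', hm'⟩ := Nat.exists_eq_add_of_le' hm1
      have hqm' : q ≤ m' := by
        refine hq.trans ?_
        rw [← Nat.lt_succ_iff, Nat.div_lt_iff_lt_mul (by omega)]
        unfold T1
        rw [hb0, hm', Nat.succ_eq_add_one]
        have : 0 < (m' + 1) * (d + 2) := by positivity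
        omega
      have hqK' : K * q ≤ m' * K := by
        rw [mul_comm]; exact Nat.mul_le_mul_right K hqm'
      have h3 := pc_lip cs hra v x z
      rw [hm', add_mul] at lx
      omega

lemma nbr (v : S) {K r d : ℕ} (hr : 0 < r) (hK : K = (d + 3) * r) {x y : W}
    (hd : cd cs x y ≤ r) :
    (T1 cs hra v K r (d + 2) x ≤ T1 cs hra v K r (d + 2) y + 1 ∧
     T1 cs hra v K r (d + 2) y ≤ T1 cs hra v K r (d + 2) x + 1) ∧
    ∀ q, q ≤ (T1 cs hra v K r (d + 2) x - 1) / (d + 2) →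
      q ≤ (T1 cs hra v K r (d + 2) y - 1) / (d + 2) →
      (pc cs hra v x).take (K * q) = (pc cs hra v y).take (K * q) := by
  rcases le_total (mm cs hra v K x) (mm cs hra v K y) with h | h
  · exact nbr_aux cs hra v hr hK hd h
  · obtain ⟨⟨a, b⟩, c⟩ := nbr_aux cs hra v hr hK (x := y) (y := x) (by rwa [cd_comm]) h
    exact ⟨⟨b, a⟩, fun q h1 h2 => (c q h2 h1).symm⟩

lemma div_eq_of_near {N a b : ℕ} (hN : 0 < N) (h1 : a ≤ b + 1) (h2 : b ≤ a + 1)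
    (ha : a % N ≠ N - 1) (hb : b % N ≠ N - 1) : a / N = b / N := by
  have aux : ∀ a : ℕ, a % N ≠ N - 1 → a / N = (a + 1) / N := by
    intro a ha
    rw [Nat.succ_div, if_neg, add_zero]
    rintro ⟨k, hk⟩
    apply ha
    cases k with
    | zero => omega
    | succ k =>
      have : a = N * k + (N - 1) := by
        rw [Nat.mul_succ] at hk; omega
      rw [this, Nat.mul_add_mod, Nat.mod_eq_of_lt (by omega)]
  have : a = b ∨ a = b + 1 ∨ b = a + 1 := by omega
  rcases this with rfl | rfl | rfl
  · rfl
  · exact (aux b hb).symm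
  · exact aux a ha

/-- Layers are uniformly close to cosets of the link subgroup. -/
lemma layer_region (v : S) (K R : ℕ) (hK : 0 < K) (q : ℕ) (u : List (W ⧸ lkS cs v)) :
    ∃ g : W, ∀ x : W, (mm cs hra v K x = q ∧ (pc cs hra v x).take (K * q) = u ∧
      ∃ z, (pc cs hra v z).length < q * K ∧ cd cs x z ≤ R) →
      g⁻¹ * x ∈ nbd cs (lkS cs v : Set W) R := by
  have key : ∀ x : W, (mm cs hra v K x = q ∧ (pc cs hra v x).take (K * q) = u ∧
      ∃ z, (pc cs hra v z).length < q * K ∧ cd cs x z ≤ R) → ∃ y, cd cs x y ≤ R ∧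
        pc cs hra v y = u.dropLast ∧ pc cs hra v (y * cs.simple v) = u := by
    rintro x ⟨h1, h2, z, h3, h4⟩
    obtain ⟨l, hl, rfl⟩ := exists_word cs x z
    have hlen : K * q ≤ (pc cs hra v x).length := by
      rw [← h1, mul_comm]; exact mm_le cs hra v K x
    obtain ⟨y, hy1, hy2, hy3⟩ := wall_word cs hra v (K * q) l x hlen (by rwa [mul_comm])
    rw [h2] at hy3
    refine ⟨y, by omega, ?_, hy3⟩
    have hul : u.length = K * q := by rw [← h2, List.length_take]; omega
    obtain ⟨i, h | h⟩ := pc_mul_v cs hra v y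
    · rw [hy3] at h
      rw [h]; simp
    · exfalso
      rw [hy3] at h
      rw [h] at hy2
      simp at hy2
      omega
  by_cases hne : ∃ x : W, (mm cs hra v K x = q ∧ (pc cs hra v x).take (K * q) = u ∧
      ∃ z, (pc cs hra v z).length < q * K ∧ cd cs x z ≤ R)
  · obtain ⟨x0, hx0⟩ := hne
    obtain ⟨g, _, hg2, hg3⟩ := key x0 hx0
    refine ⟨g, fun x hx => ?_⟩
    obtain ⟨y, hy1, hy2, hy3⟩ := key x hx
    refine ⟨g⁻¹ * y, wall_unique cs hra v (by rw [hg2, hy2]) (by rw [hg3, hy3]), ?_⟩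
    rwa [cd_mul]
  · exact ⟨1, fun x hx => absurd ⟨x, hx⟩ hne⟩

lemma block_region (v : S) (n k : ℕ) (u : List (W ⧸ lkS cs v)) :
    ∃ g : W, ∀ x : W, ((pc cs hra v x).length ≤ n + k ∧ (pc cs hra v x).take n = u) →
      g⁻¹ * x ∈ {x | (pc cs hra v x).length ≤ k} := by
  by_cases hne : ∃ x : W, (pc cs hra v x).take n = u
  · obtain ⟨x0, rfl⟩ := hne
    obtain ⟨g, hg⟩ := exists_pc cs hra v n x0
    refine ⟨g, fun x hx => ?_⟩
    have := pc_mul_len cs hra v (hg.trans hx.2.symm)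
    have h1 := hx.1
    show (pc cs hra v (g⁻¹ * x)).length ≤ k
    omega
  · exact ⟨1, fun x hx => absurd ⟨x, hx.2⟩ hne⟩

end Main
section Glue

variable {S : Type*} {M : CoxeterMatrix S} {W : Type*} [Group W] (cs : CoxeterSystem M W)
variable (hra : ∀ s t : S, s ≠ t → M s t = 2 ∨ M s t = 0)

/-- Type of a point. -/
noncomputable def ty (v : S) (K r d : ℕ) (x : W) : ℕ := (T1 cs hra v K r (d + 2) x - 1) % (d + 2)

/-- Block number of a point. -/
noncomputable def qq (v : S) (K r d : ℕ) (x : W) : ℕ := (T1 cs hra v K r (d + 2) x - 1) / (d + 2)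

lemma ty_cases (v : S) (K r d : ℕ) (x : W) :
    (1 ≤ bb cs hra v K r (d + 2) x ∧ qq cs hra v K r d x = mm cs hra v K x ∧
      ty cs hra v K r d x = bb cs hra v K r (d + 2) x - 1) ∨
    (bb cs hra v K r (d + 2) x = 0 ∧ mm cs hra v K x = qq cs hra v K r d x + 1 ∧
      ty cs hra v K r d x = d + 1) := by
  have hle := bb_le cs hra v K r (d + 2) x
  have hge := T1_ge cs hra v K r (d + 2) x
  unfold ty qq
  unfold T1 at *
  generalize bb cs hra v K r (d + 2) x = b at *
  generalize mm cs hra v K x = m at *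
  rcases Nat.eq_zero_or_pos b with rfl | hb
  · right
    obtain _ | m := m
    · omega
    · have : (m + 1) * (d + 2) + 0 - 1 = (d + 2) * m + (d + 1) := by
        have : (m + 1) * (d + 2) = (d + 2) * m + (d + 2) := by ring
        omega
      rw [this, Nat.mul_add_div (by omega), Nat.mul_add_mod, Nat.mod_eq_of_lt (by omega),
        Nat.div_eq_of_lt (by omega)]
      simp
  · left
    have : m * (d + 2) + b - 1 = (d + 2) * m + (b - 1) := by
      have : m * (d + 2) = (d + 2) * m := by ring
      omega
    rw [this, Nat.mul_add_div (by omega), Nat.mul_add_mod, Nat.mod_eq_of_lt (by omega),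
        Nat.div_eq_of_lt (by omega)]
    simp; omega

lemma ty_le (v : S) (K r d : ℕ) (x : W) : ty cs hra v K r d x ≤ d + 1 := by
  have : ty cs hra v K r d x < d + 2 := Nat.mod_lt _ (by omega)
  omega

lemma layers (v : S) {K r d : ℕ} (hr : 0 < r) (hK : K = (d + 3) * r) (hd1 : 1 ≤ d)
    (hL : HasCol cs (lkS cs v : Set W) d) (j : ℕ) (hj : j ≤ d + 1) :
    ∃ E : ℕ, ∃ c : W → Fin (d + 1), (∀ x, (c x).val ≠ ty cs hra v K r d x) ∧
      ∀ x y, ReflTransGen (Stp cs c {x | ty cs hra v K r d x < j} r) x y → cd cs x y ≤ E := by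
  classical
  have hK0 : 0 < K := by rw [hK]; positivity
  induction j with
  | zero =>
    refine ⟨0, fun x => if ty cs hra v K r d x = 0 then ⟨1, by omega⟩ else ⟨0, by omega⟩, ?_, ?_⟩
    · intro x
      by_cases h : ty cs hra v K r d x = 0
      · simp [h]
      · simp only [h, if_false]; exact fun h' => h h'.symm
    · intro x y hxy
      rcases hxy.cases_head with rfl | ⟨z, hz, _⟩
      · rw [cd_self]
      · exact absurd hz.1 (by simp)
  | succ j ih =>
    obtain ⟨E, c0, hne0, hc0⟩ := ih (by omega)
    set Z : Set W := {x | ty cs hra v K r d x = j} with hZ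
    set key : W → ℕ × List (W ⧸ lkS cs v) := fun x =>
      (qq cs hra v K r d x, (pc cs hra v x).take (K * qq cs hra v K r d x)) with hkey
    obtain ⟨D, c1, hc1⟩ := (hL.nbd cs ((d + 2) * r)).family cs key Z (by
      rintro ⟨q, u⟩
      obtain ⟨g, hg⟩ := layer_region cs hra v K ((d + 2) * r) hK0 q u
      refine ⟨g, fun x hx hk => hg x ?_⟩
      have hx : ty cs hra v K r d x = j := hx
      simp only [hkey, Prod.mk.injEq] at hk
      obtain ⟨hk1, hk2⟩ := hk
      rw [hk1] at hk2
      rcases ty_cases cs hra v K r d x with ⟨h1, h2, h3⟩ | ⟨h1, h2, h3⟩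
      · refine ⟨by rw [← h2, hk1], hk2, ?_⟩
        rcases bb_spec cs hra v K r (d + 2) x with h | ⟨z, h4, h5⟩
        · omega
        · refine ⟨z, by rwa [← h2, hk1] at h4, h5.trans ?_⟩
          exact Nat.mul_le_mul_right r (by omega)
      · omega) (E + 2 * r)
    set p : Fin (d + 1) := ⟨j, by omega⟩ with hp
    set c : W → Fin (d + 1) := fun x => if x ∈ Z then p.succAbove (c1 x) else c0 x with hc
    refine ⟨2 * E + 2 * r + D, c, ?_, fun x y hxy => ?_⟩
    · intro x
      by_cases hx : x ∈ Z
      · simp only [hc, hx, if_true]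
        have hx : ty cs hra v K r d x = j := hx
        intro h
        apply Fin.succAbove_ne p (c1 x)
        ext
        rw [h, hx]
      · simp only [hc, hx, if_false]
        exact hne0 x
    · refine overlay cs key c c0 {x | ty cs hra v K r d x < j} Z r E D ?_ hc0 ?_ ?_ x y ?_
      · intro x hx
        have hx : ty cs hra v K r d x < j := hx
        have : x ∉ Z := fun h => by
          have h : ty cs hra v K r d x = j := h
          omega
        simp [hc, this]
      · intro x y hxy
        refine hc1 x y (ReflTransGen.mono ?_ _ _ hxy)
        rintro a b ⟨⟨ha, hb, hcol, hd⟩, hk⟩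
        refine ⟨⟨ha, hb, ?_, hd⟩, hk⟩
        simp only [hc, ha, hb, if_true] at hcol
        exact Fin.succAbove_right_injective hcol
      · rintro x y ⟨hx, hy, -, hd⟩
        have aux : ∀ x : W, x ∈ {x | ty cs hra v K r d x < j} ∪ Z → ty cs hra v K r d x ≤ d := by
          rintro x (h | h)
          · have h : ty cs hra v K r d x < j := h
            omega
          · have h : ty cs hra v K r d x = j := h
            omega
        have ax := aux x hx
        have ay := aux y hy
        obtain ⟨⟨n1, n2⟩, n3⟩ := nbr cs hra v hr hK hd
        have gx := T1_ge cs hra v K r (d + 2) x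
        have gy := T1_ge cs hra v K r (d + 2) y
        have e : qq cs hra v K r d x = qq cs hra v K r d y := by
          unfold qq
          refine div_eq_of_near (by omega) (by omega) (by omega) ?_ ?_
          · change ty cs hra v K r d x ≠ _
            omega
          · change ty cs hra v K r d y ≠ _
            omega
        have := n3 (qq cs hra v K r d x) le_rfl (by rw [e]; exact le_rfl)
        simp only [hkey]
        rw [this, e]
      · refine ReflTransGen.mono ?_ _ _ hxy
        have aux : ∀ x : W, x ∈ {x | ty cs hra v K r d x < j + 1} →
            x ∈ {x | ty cs hra v K r d x < j} ∪ Z := by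
          intro x hx
          have hx : ty cs hra v K r d x < j + 1 := hx
          rcases Nat.lt_succ_iff_lt_or_eq.1 hx with h | h
          · exact .inl h
          · exact .inr h
        rintro a b ⟨ha, hb, hcol, hd⟩
        exact ⟨aux a ha, aux b hb, hcol, hd⟩

lemma glue_pos (hra : ∀ s t : S, s ≠ t → M s t = 2 ∨ M s t = 0) (v : S) {r d : ℕ} (hr : 0 < r) (hd1 : 1 ≤ d)
    (hA : HasCol cs (coS cs v : Set W) (d + 1)) (hL : HasCol cs (lkS cs v : Set W) d) :
    ∃ D : ℕ, ∃ c : W → Fin (d + 1),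
      ∀ x y, ReflTransGen (Stp cs c Set.univ r) x y → cd cs x y ≤ D := by
  classical
  obtain ⟨K, hK⟩ : ∃ K, K = (d + 3) * r := ⟨_, rfl⟩
  have hK0 : 0 < K := by rw [hK]; positivity
  obtain ⟨E, c0, hne0, hc0⟩ := layers cs hra v hr hK hd1 hL (d + 1) le_rfl
  set Z : Set W := {x | ty cs hra v K r d x = d + 1} with hZ
  obtain ⟨D, c1, hc1⟩ := (ball_col cs hra v hA (2 * K)).family cs
    (fun x => (qq cs hra v K r d x, (pc cs hra v x).take (K * qq cs hra v K r d x))) Z (by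
      rintro ⟨q, u⟩
      obtain ⟨g, hg⟩ := block_region cs hra v (K * q) (2 * K) u
      refine ⟨g, fun x hx hk => hg x ?_⟩
      simp only [Prod.mk.injEq] at hk
      obtain ⟨hk1, hk2⟩ := hk
      rw [hk1] at hk2
      refine ⟨?_, hk2⟩
      have h1 := lt_mm cs hra v hK0 x
      have h2 : mm cs hra v K x ≤ q + 1 := by
        rcases ty_cases cs hra v K r d x with ⟨h1, h2, h3⟩ | ⟨h1, h2, h3⟩ <;> omega
      have h3 : mm cs hra v K x * K ≤ (q + 1) * K := Nat.mul_le_mul_right K h2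
      have h4 : (q + 1) * K = K * q + K := by ring
      omega) (E + 2 * r)
  set c : W → Fin (d + 1) := fun x => if x ∈ Z then c1 x else c0 x with hc
  have hne : ∀ x, (c x).val ≠ ty cs hra v K r d x := by
    intro x
    by_cases hx : x ∈ Z
    · have hx : ty cs hra v K r d x = d + 1 := hx
      have := (c x).isLt
      omega
    · simp only [hc, hx, if_false]
      exact hne0 x
  set ka : W → ℕ := fun x => (T1 cs hra v K r (d + 2) x - (c x).val - 2) / (d + 2) with hka
  have ka_le : ∀ x, ka x ≤ qq cs hra v K r d x := by
    intro x
    exact Nat.div_le_div_right (by omega)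
  have ka_mod : ∀ x, (T1 cs hra v K r (d + 2) x - (c x).val - 2) % (d + 2) ≠ d + 2 - 1 := by
    intro x h
    apply hne x
    have gx := T1_ge cs hra v K r (d + 2) x
    have hlt := (c x).isLt
    have h1 := Nat.div_add_mod (T1 cs hra v K r (d + 2) x - (c x).val - 2) (d + 2)
    rw [h] at h1
    have h2 : T1 cs hra v K r (d + 2) x - 1 = (d + 2) * (ka x + 1) + (c x).val := by
      rw [Nat.mul_succ]
      simp only [hka]
      omega
    unfold ty
    rw [h2, Nat.mul_add_mod, Nat.mod_eq_of_lt (by omega)]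
  have ka_Z : ∀ x ∈ Z, ka x = qq cs hra v K r d x := by
    intro x hx
    have hx : ty cs hra v K r d x = d + 1 := hx
    have hlt := (c x).isLt
    have h1 := Nat.div_add_mod (T1 cs hra v K r (d + 2) x - 1) (d + 2)
    have h2 : (T1 cs hra v K r (d + 2) x - 1) % (d + 2) = d + 1 := hx
    rw [h2] at h1
    have h3 : T1 cs hra v K r (d + 2) x - (c x).val - 2 =
        (d + 2) * qq cs hra v K r d x + (d - (c x).val) := by
      unfold qq
      omega
    simp only [hka]
    rw [h3, Nat.mul_add_div (by omega), Nat.div_eq_of_lt (by omega), add_zero]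
  refine ⟨2 * E + 2 * r + D, c, fun x y hxy => ?_⟩
  refine overlay cs (fun x => (ka x, (pc cs hra v x).take (K * ka x))) c c0
    {x | ty cs hra v K r d x < d + 1} Z r E D ?_ hc0 ?_ ?_ x y ?_
  · intro x hx
    have hx : ty cs hra v K r d x < d + 1 := hx
    have : x ∉ Z := fun h => by
      have h : ty cs hra v K r d x = d + 1 := h
      omega
    simp [hc, this]
  · intro x y hxy
    refine hc1 x y (ReflTransGen.mono ?_ _ _ hxy)
    rintro a b ⟨⟨ha, hb, hcol, hd⟩, hk⟩
    refine ⟨⟨ha, hb, ?_, hd⟩, ?_⟩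
    · simpa only [hc, ha, hb, if_true] using hcol
    · simpa only [ka_Z a ha, ka_Z b hb] using hk
  · rintro x y ⟨-, -, hcol, hd⟩
    obtain ⟨⟨n1, n2⟩, n3⟩ := nbr cs hra v hr hK hd
    have e : ka x = ka y := by
      have mx := ka_mod x
      have my := ka_mod y
      simp only [hka]
      rw [hcol] at mx ⊢
      exact div_eq_of_near (by omega) (by omega) (by omega) mx my
    have := n3 (ka x) (ka_le x) (by rw [e]; exact ka_le y)
    rw [this, e]
  · refine ReflTransGen.mono ?_ _ _ hxy
    have aux : ∀ x : W, x ∈ {x | ty cs hra v K r d x < d + 1} ∪ Z := by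
      intro x
      rcases (ty_le cs hra v K r d x).lt_or_eq with h | h
      · exact .inl h
      · exact .inr h
    rintro a b ⟨ha, hb, hcol, hd⟩
    exact ⟨aux a, aux b, hcol, hd⟩

lemma glue (v : S) {d : ℕ} (hd1 : 1 ≤ d)
    (hra : ∀ s t : S, s ≠ t → M s t = 2 ∨ M s t = 0)
    (hA : HasCol cs (coS cs v : Set W) (d + 1)) (hL : HasCol cs (lkS cs v : Set W) d) :
    HasCol cs Set.univ (d + 1) := by
  intro r
  obtain ⟨D, c, h⟩ := glue_pos cs hra v (r := r + 1) (by omega) hd1 hA hL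
  refine ⟨D, c, fun x y hxy => h x y (ReflTransGen.mono ?_ _ _ hxy)⟩
  rintro a b ⟨ha, hb, hcol, hd⟩
  exact ⟨ha, hb, hcol, by omega⟩

end Glue
section Transfer

variable {S : Type*} {M : CoxeterMatrix S} {W : Type*} [Group W] (cs : CoxeterSystem M W)

/-- Restriction of a Coxeter matrix to a subset. -/
def resM (M : CoxeterMatrix S) (T : Set S) : CoxeterMatrix T where
  M := fun s t => M s.1 t.1
  isSymm := by
    ext s t
    exact M.symmetric t.1 s.1
  diagonal s := M.diagonal s.1
  off_diagonal s t h := M.off_diagonal s.1 t.1 fun h' => h (Subtype.ext h')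

lemma length_hom_le {S' : Type*} {M' : CoxeterMatrix S'} {W' : Type*} [Group W']
    (cs' : CoxeterSystem M' W') (φ : W →* W') (h : ∀ s, cs'.length (φ (cs.simple s)) ≤ 1) (x : W) :
    cs'.length (φ x) ≤ cs.length x := by
  obtain ⟨l, h1, h2⟩ := cs.exists_isReduced x
  have h3 : cs.length x = l.length := by rw [h2]; exact h1
  rw [h3, h2]
  clear h1 h2 h3
  induction l with
  | nil => simp
  | cons s l ih =>
    rw [cs.wordProd_cons, map_mul, List.length_cons]
    have := cs'.length_mul_le (φ (cs.simple s)) (φ (cs.wordProd l))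
    have := h s
    omega

lemma transfer (hra : ∀ s t : S, s ≠ t → M s t = 2 ∨ M s t = 0) (T : Set S) {n : ℕ}
    (h : HasCol (resM M T).toCoxeterSystem Set.univ n) :
    HasCol cs (Subgroup.closure (cs.simple '' T) : Set W) n := by
  classical
  set cs' := (resM M T).toCoxeterSystem with hcs'
  have l1 : (resM M T).IsLiftable (fun s : T => cs.simple s.1) := by
    intro s t
    exact cs.simple_mul_simple_pow s.1 t.1
  have l2 : M.IsLiftable (fun s : S => if hs : s ∈ T then cs'.simple ⟨s, hs⟩ else 1) := by
    intro s t
    by_cases hs : s ∈ T <;> by_cases ht : t ∈ T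
    · simp only [hs, ht, dif_pos]
      exact cs'.simple_mul_simple_pow ⟨s, hs⟩ ⟨t, ht⟩
    · have hne : s ≠ t := fun e => ht (e ▸ hs)
      rcases hra s t hne with e | e <;> simp [hs, ht, e]
    · have hne : s ≠ t := fun e => hs (e ▸ ht)
      rcases hra s t hne with e | e <;> simp [hs, ht, e]
    · simp [hs, ht]
  set i : (resM M T).Group →* W := cs'.lift ⟨_, l1⟩ with hi
  set ρ : W →* (resM M T).Group := cs.lift ⟨_, l2⟩ with hρ
  have i_s : ∀ s : T, i (cs'.simple s) = cs.simple s.1 := fun s => cs'.lift_apply_simple l1 s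
  have ρ_s : ∀ s : S, ρ (cs.simple s) = if hs : s ∈ T then cs'.simple ⟨s, hs⟩ else 1 :=
    fun s => cs.lift_apply_simple l2 s
  have i_len := length_hom_le cs' cs i (fun s => by rw [i_s, cs.length_simple])
  have ρ_len := length_hom_le cs cs' ρ (fun s => by
    rw [ρ_s]
    split_ifs
    · rw [cs'.length_simple]
    · simp)
  have iρ : ∀ x ∈ Subgroup.closure (cs.simple '' T), i (ρ x) = x := by
    intro x hx
    induction hx using Subgroup.closure_induction with
    | mem x hx =>
      obtain ⟨s, hs, rfl⟩ := hx
      rw [ρ_s, dif_pos hs, i_s]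
    | one => simp
    | mul x y _ _ hx hy => rw [map_mul, map_mul, hx, hy]
    | inv x _ hx => rw [map_inv, map_inv, hx]
  intro r
  obtain ⟨D, c, hc⟩ := h r
  refine ⟨D, fun x => c (ρ x), fun x y hxy => ?_⟩
  rcases eq_or_ne x y with rfl | hne
  · simp [cd_self]
  have hx : x ∈ Subgroup.closure (cs.simple '' T) := by
    rcases hxy.cases_head with h | ⟨z, hz, _⟩
    · exact absurd h hne
    · exact hz.1
  have hy : y ∈ Subgroup.closure (cs.simple '' T) := by
    rcases hxy.cases_tail with h | ⟨z, _, hz⟩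
    · exact absurd h hne.symm
    · exact hz.2.1
  have h1 : ReflTransGen (Stp cs' c Set.univ r) (ρ x) (ρ y) := by
    refine hxy.lift ρ ?_
    rintro a b ⟨-, -, hcab, hd⟩
    refine ⟨trivial, trivial, hcab, le_trans ?_ hd⟩
    unfold cd
    rw [← map_inv, ← map_mul]
    exact ρ_len _
  refine le_trans ?_ (hc _ _ h1)
  unfold cd
  have := i_len ((ρ x)⁻¹ * ρ y)
  rwa [map_mul, map_inv, iρ x hx, iρ y hy] at this

end Transfer

section Final

universe u

/-- Clique number bound. -/
def CliqueLE {S : Type*} (M : CoxeterMatrix S) (w : ℕ) : Prop :=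
  ∀ T : Finset S, (∀ s ∈ T, ∀ t ∈ T, s ≠ t → M s t = 2) → T.card ≤ w

lemma main_ind (k : ℕ) : ∀ (S : Type u) [Finite S] (M : CoxeterMatrix S), Nat.card S = k →
    (∀ s t : S, s ≠ t → M s t = 2 ∨ M s t = 0) → ∀ w : ℕ, CliqueLE M w →
    HasCol M.toCoxeterSystem Set.univ (w + 1) := by
  classical
  induction k using Nat.strong_induction_on with
  | _ k ih =>
    intro S _ M hk hra w hw
    rcases isEmpty_or_nonempty S with hS | ⟨⟨v⟩⟩
    · intro r
      refine ⟨0, fun _ => 0, fun x y _ => ?_⟩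
      obtain ⟨l, h1, h2⟩ := exists_word M.toCoxeterSystem x y
      rw [← h1]
      cases l with
      | nil => simp
      | cons s l => exact hS.elim s
    · have hw1 : 1 ≤ w := by
        have := hw {v} (by simp)
        simpa using this
      have hcard : ∀ T : Set S, v ∉ T → Nat.card T < k := by
        intro T hT
        rw [← hk]
        have := Set.ncard_lt_card (s := T) (fun h => hT (h ▸ Set.mem_univ v))
        exact this
      have hraT : ∀ T : Set S, ∀ s t : T, s ≠ t → resM M T s t = 2 ∨ resM M T s t = 0 :=
        fun T s t hst => hra s.1 t.1 fun h => hst (Subtype.ext h)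
      refine glue M.toCoxeterSystem v hw1 hra ?_ ?_
      · refine transfer M.toCoxeterSystem hra {s | s ≠ v} ?_
        refine ih _ (hcard _ (by simp)) _ _ rfl (hraT _) w ?_
        intro T hT
        have := hw (T.map (Function.Embedding.subtype _)) (by
          intro s hs t ht hst
          obtain ⟨s, hs', rfl⟩ := Finset.mem_map.1 hs
          obtain ⟨t, ht', rfl⟩ := Finset.mem_map.1 ht
          exact hT s hs' t ht' fun e => hst (by rw [e]))
        rwa [Finset.card_map] at this
      · refine transfer M.toCoxeterSystem hra {s | s ≠ v ∧ M v s = 2} ?_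
        obtain ⟨w', rfl⟩ := Nat.exists_eq_add_of_le' hw1
        refine ih _ (hcard _ (by simp)) _ _ rfl (hraT _) w' ?_
        intro T hT
        have hv : v ∉ T.map (Function.Embedding.subtype _) := by
          intro h
          obtain ⟨s, hs, e⟩ := Finset.mem_map.1 h
          exact s.2.1 e
        have := hw (insert v (T.map (Function.Embedding.subtype _))) (by
          intro s hs t ht hst
          rcases Finset.mem_insert.1 hs with rfl | hs
          · rcases Finset.mem_insert.1 ht with rfl | ht
            · exact absurd rfl hst
            · obtain ⟨t, ht', rfl⟩ := Finset.mem_map.1 ht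
              exact t.2.2
          · obtain ⟨s, hs', rfl⟩ := Finset.mem_map.1 hs
            rcases Finset.mem_insert.1 ht with rfl | ht
            · rw [M.symmetric]
              exact s.2.2
            · obtain ⟨t, ht', rfl⟩ := Finset.mem_map.1 ht
              exact hT s hs' t ht' fun e => hst (by rw [e]))
        rw [Finset.card_insert_of_notMem hv, Finset.card_map] at this
        omega

lemma hasCol_univ {S : Type*} [Finite S] {M : CoxeterMatrix S} {W : Type*} [Group W]
    (cs : CoxeterSystem M W) (hra : ∀ s t : S, s ≠ t → M s t = 2 ∨ M s t = 0) (w : ℕ)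
    (hw : CliqueLE M w) : HasCol cs Set.univ (w + 1) := by
  have h := transfer cs hra Set.univ (n := w + 1) (main_ind _ _ _ rfl
    (fun s t hst => hra s.1 t.1 fun h => hst (Subtype.ext h)) w (by
      intro T hT
      have := hw (T.map (Function.Embedding.subtype _)) (by
          intro s hs t ht hst
          obtain ⟨s, hs', rfl⟩ := Finset.mem_map.1 hs
          obtain ⟨t, ht', rfl⟩ := Finset.mem_map.1 ht
          exact hT s hs' t ht' fun e => hst (by rw [e]))
      rwa [Finset.card_map] at this))
  rw [Set.image_univ, cs.subgroup_closure_range_simple] at h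
  exact h

lemma wordNorm_eq {S : Type*} {M : CoxeterMatrix S} {W : Type*} [Group W]
    (cs : CoxeterSystem M W) (x : W) : wordNorm (Set.range cs.simple) x = cs.length x := by
  unfold wordNorm
  apply le_antisymm
  · apply Nat.sInf_le
    obtain ⟨l, h1, h2⟩ := cs.exists_isReduced x
    refine ⟨l.map cs.simple, ?_, ?_, h2.symm⟩
    · rw [List.length_map, h2]; exact h1.symm
    · intro y hy
      obtain ⟨s, _, rfl⟩ := List.mem_map.1 hy
      exact ⟨s, rfl⟩
  · refine le_csInf ?_ ?_
    · obtain ⟨l, h2⟩ := cs.wordProd_surjective x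
      refine ⟨_, l.map cs.simple, rfl, ?_, h2⟩
      intro y hy
      obtain ⟨s, _, rfl⟩ := List.mem_map.1 hy
      exact ⟨s, rfl⟩
    · rintro k ⟨l, rfl, hl, rfl⟩
      have : ∃ l' : List S, l'.map cs.simple = l := by
        have : l ∈ Set.range (List.map cs.simple) := by
          rw [Set.range_list_map]; exact hl
        exact this
      obtain ⟨l', rfl⟩ := this
      rw [List.length_map]
      exact cs.length_wordProd_le l'

lemma asdimLE_of_hasCol {S : Type*} {M : CoxeterMatrix S} {W : Type*} [Group W]
    (cs : CoxeterSystem M W) (n : ℕ) (h : HasCol cs Set.univ (n + 1)) :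
    AsdimLE (fun g h : W => wordDist (Set.range cs.simple) g h) n := by
  have hd : ∀ x y : W, wordDist (Set.range cs.simple) x y = (cd cs x y : ℝ) := by
    intro x y
    unfold wordDist cd
    rw [wordNorm_eq]
  intro r hr
  obtain ⟨D, c, hc⟩ := h ⌈r⌉₊
  have hsymm : ∀ x y, Stp cs c Set.univ ⌈r⌉₊ x y → Stp cs c Set.univ ⌈r⌉₊ y x := by
    rintro x y ⟨-, -, h1, h2⟩
    exact ⟨trivial, trivial, h1.symm, by rwa [cd_comm]⟩
  have rsymm : ∀ x y, ReflTransGen (Stp cs c Set.univ ⌈r⌉₊) x y →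
      ReflTransGen (Stp cs c Set.univ ⌈r⌉₊) y x := by
    intro x y hxy
    induction hxy with
    | refl => exact .refl
    | tail _ h ih => exact ReflTransGen.head (hsymm _ _ h) ih
  have rcol : ∀ x y, ReflTransGen (Stp cs c Set.univ ⌈r⌉₊) x y → c x = c y := by
    intro x y hxy
    induction hxy with
    | refl => rfl
    | tail _ h ih => exact ih.trans h.2.2.1
  refine ⟨fun i => {U | ∃ x, c x = i ∧ U = {y | ReflTransGen (Stp cs c Set.univ ⌈r⌉₊) x y}},
    D, ?_, ?_, ?_⟩
  · rintro i U ⟨a, ha, rfl⟩ V ⟨b, hb, rfl⟩ hne x hx y hy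
    simp only [Set.mem_ofPred_eq] at hx hy
    simp only [hd]
    by_contra hlt
    push Not at hlt
    apply hne
    have hxy : Stp cs c Set.univ ⌈r⌉₊ x y := by
      refine ⟨trivial, trivial, ?_, ?_⟩
      · rw [← rcol _ _ hx, ← rcol _ _ hy, ha, hb]
      · have : (cd cs x y : ℝ) ≤ ⌈r⌉₊ := hlt.le.trans (Nat.le_ceil r)
        exact_mod_cast this
    have hab : ReflTransGen (Stp cs c Set.univ ⌈r⌉₊) a b :=
      (hx.tail hxy).trans (rsymm _ _ hy)
    ext z
    exact ⟨fun hz => (rsymm _ _ hab).trans hz, fun hz => hab.trans hz⟩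
  · rintro i U ⟨a, ha, rfl⟩ x hx y hy
    simp only [Set.mem_ofPred_eq] at hx hy
    simp only [hd]
    exact_mod_cast hc _ _ ((rsymm _ _ hx).trans hy)
  · intro x
    exact ⟨c x, _, ⟨x, rfl, rfl⟩, .refl⟩

end Final

end RACG

/-- **Theorem 3.1.** Let `(Γ, S)` be a right-angled Coxeter system with `S`
finite. Then `asdim Γ ≤ dim N(Γ) + 1`, where `N(Γ)` is the nerve of the
system and `Γ` carries the word metric with respect to the set of simple
reflections.  The hypothesis `hdim` states that `dim N(Γ) ≤ n`: every subset
`T ⊆ S` spanning a simplex of the nerve (i.e. with `Γ_T` finite, which for a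
right-angled system means `m_{s t} = 2` for all distinct `s, t ∈ T`) has
cardinality at most `n + 1`. -/
theorem asdim_rightAngled_coxeter_le {S : Type*} [Finite S] (M : CoxeterMatrix S)
    {W : Type*} [Group W] (cs : CoxeterSystem M W)
    (hra : ∀ s t : S, s ≠ t → M s t = 2 ∨ M s t = 0)
    (n : ℕ)
    (hdim : ∀ T : Finset S, (∀ s ∈ T, ∀ t ∈ T, s ≠ t → M s t = 2) → T.card ≤ n + 1) :
    asDim (fun g h : W => wordDist (Set.range cs.simple) g h) ≤ (n : ℕ∞) + 1 := by
  have h := RACG.hasCol_univ cs hra (n + 1) hdim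
  have h2 := RACG.asdimLE_of_hasCol cs (n + 1) h
  exact sInf_le ⟨n + 1, by simp, h2⟩
end

section
/- Let X be a geodesic metric space and n ≥ 1. Suppose that for every R > 0 there exist d > 0 and a partition X = ⋃_{i=1}^∞ W_i such that asdim W_i ≤ n uniformly in i and (R,d)-dim(⋃_i ∂W_i) ≤ n−1, where ⋃_i ∂W_i carries the metric restricted from X and ∂W_i is the topological boundary of W_i in X. Then asdim X ≤ n. -/
/-- `CoverOrdLE 𝒰 m` : the order of the family `𝒰` (the maximal number of
members of `𝒰` having a common point) is at most `m`. -/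
def CoverOrdLE {Y : Type*} (𝒰 : Set (Set Y)) (m : ℕ) : Prop :=
  ∀ T : Finset (Set Y), ↑T ⊆ 𝒰 → (⋂₀ (T : Set (Set Y))).Nonempty → T.card ≤ m

/-- `IsRDCoverOn A r d 𝒰` : `𝒰` is an `(r,d)`-cover of the subset `A` of the
metric space `Y`: a cover of `A` by subsets of `A` of diameter at most `d`
whose Lebesgue number `L(𝒰) = inf_{x ∈ A} sup_{U ∈ 𝒰} d(x, A ∖ U)` is greater
than `r` (the infimum and supremum are computed in `ℝ≥0∞`, so that
`d(x, ∅) = ∞`). -/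
def IsRDCoverOn {Y : Type*} [MetricSpace Y] (A : Set Y) (r d : ℝ)
    (𝒰 : Set (Set Y)) : Prop :=
  (∀ U ∈ 𝒰, U ⊆ A) ∧ (A ⊆ ⋃₀ 𝒰) ∧
  (∀ U ∈ 𝒰, ∀ x ∈ U, ∀ y ∈ U, dist x y ≤ d) ∧
  ENNReal.ofReal r < ⨅ x ∈ A, ⨆ U ∈ 𝒰, EMetric.infEdist x (A \ U)

/-- A metric space is geodesic if every two points are joined by an isometric
image of a real interval. -/
def IsGeodesicSpace (X : Type*) [MetricSpace X] : Prop :=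
  ∀ x y : X, ∃ f : ℝ → X, f 0 = x ∧ f (dist x y) = y ∧
    ∀ s ∈ Set.Icc (0 : ℝ) (dist x y), ∀ t ∈ Set.Icc (0 : ℝ) (dist x y),
      dist (f s) (f t) = |s - t|

/-- The family of subsets `W i` of `X` satisfies `asdim (W i) ≤ n` uniformly:
for every `r > 0` there is a common bound `R` such that every `W i` is covered
by `n + 1` families of `r`-disjoint `R`-bounded subsets of `W i`. -/
def AsdimUnifLE {X : Type*} [MetricSpace X] {ι : Type*} (W : ι → Set X)
    (n : ℕ) : Prop :=
  ∀ r : ℝ, 0 < r → ∃ R : ℝ, ∀ i : ι, ∃ 𝒰 : Fin (n + 1) → Set (Set X),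
    (∀ k, ∀ U ∈ 𝒰 k, U ⊆ W i) ∧
    (∀ k, ∀ U ∈ 𝒰 k, ∀ V ∈ 𝒰 k, U ≠ V → ∀ x ∈ U, ∀ y ∈ V, r ≤ dist x y) ∧
    (∀ k, ∀ U ∈ 𝒰 k, ∀ x ∈ U, ∀ y ∈ U, dist x y ≤ R) ∧
    (W i ⊆ ⋃ k, ⋃₀ 𝒰 k)

open Metric Set

lemma frontier_on_geodesic {X : Type*} [MetricSpace X] (hgeo : IsGeodesicSpace X)
    (W : Set X) (x y : X) (hx : x ∈ W) (hy : y ∉ W) :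
    ∃ z ∈ frontier W, dist x z ≤ dist x y := by
  obtain ⟨f, h0, h1, hf⟩ := hgeo x y
  have hd : (0 : ℝ) ≤ dist x y := dist_nonneg
  have hcont : ContinuousOn f (Icc 0 (dist x y)) := by
    have : LipschitzOnWith 1 f (Icc 0 (dist x y)) := by
      apply LipschitzOnWith.of_dist_le_mul
      intro s hs t ht
      rw [hf s hs t ht, Real.dist_eq]
      simp
    exact this.continuousOn
  have hpre : IsPreconnected (f '' Icc 0 (dist x y)) := isPreconnected_Icc.image f hcont
  have h0m : (0 : ℝ) ∈ Icc 0 (dist x y) := ⟨le_refl _, hd⟩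
  have h1m : dist x y ∈ Icc 0 (dist x y) := ⟨hd, le_refl _⟩
  have hne : (f '' Icc 0 (dist x y) ∩ frontier W).Nonempty := by
    by_contra hcon
    rw [Set.not_nonempty_iff_eq_empty] at hcon
    have hcover : f '' Icc 0 (dist x y) ⊆ interior W ∪ interior Wᶜ := by
      intro z hz
      by_contra hz2
      have : z ∈ f '' Icc 0 (dist x y) ∩ frontier W := by
        refine ⟨hz, ?_⟩
        simp only [interior_compl, mem_union, mem_compl_iff, not_or, not_not] at hz2
        exact ⟨hz2.2, hz2.1⟩
      rw [hcon] at this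
      exact this
    have hx' : x ∈ f '' Icc 0 (dist x y) := ⟨0, h0m, h0⟩
    have hy' : y ∈ f '' Icc 0 (dist x y) := ⟨_, h1m, h1⟩
    have hxi : x ∈ interior W := by
      rcases hcover hx' with h | h
      · exact h
      · exact absurd hx (interior_subset h)
    have hyi : y ∈ interior Wᶜ := by
      rcases hcover hy' with h | h
      · exact absurd (interior_subset h) hy
      · exact h
    obtain ⟨z, _, hz1, hz2⟩ := hpre _ _ isOpen_interior isOpen_interior hcover
      ⟨x, hx', hxi⟩ ⟨y, hy', hyi⟩
    exact (interior_subset hz2) (interior_subset hz1)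
  obtain ⟨z, ⟨t, ht, rfl⟩, hz⟩ := hne
  refine ⟨f t, hz, ?_⟩
  have := hf 0 h0m t ht
  rw [h0] at this
  rw [this, zero_sub, abs_neg, abs_of_nonneg ht.1]
  exact ht.2

lemma colorize {X : Type*} [MetricSpace X] (A : Set X) (𝒰 : Set (Set X)) (m : ℕ) (δ D : ℝ)
    (hδ : 0 < δ) (hD : ∀ U ∈ 𝒰, ∀ x ∈ U, ∀ y ∈ U, dist x y ≤ D)
    (hord : ∀ x ∈ A, {U ∈ 𝒰 | x ∈ U}.encard ≤ m)
    (hleb : ∀ x ∈ A, ∃ U ∈ 𝒰, closedBall x (m * δ) ∩ A ⊆ U) :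
    ∃ 𝒱 : Fin m → Set (Set X),
      (∀ i, ∀ U ∈ 𝒱 i, ∀ V ∈ 𝒱 i, U ≠ V → ∀ x ∈ U, ∀ y ∈ V, δ ≤ dist x y) ∧
      (∀ i, ∀ U ∈ 𝒱 i, ∀ x ∈ U, ∀ y ∈ U, dist x y ≤ D) ∧
      (∀ x ∈ A, ∃ i, ∃ U ∈ 𝒱 i, x ∈ U) := by
  let S : ℕ → X → Set (Set X) := fun j x => {U ∈ 𝒰 | closedBall x (j * δ) ∩ A ⊆ U}
  let P : Set (Set X) → Set X := fun T => {x ∈ A | ∃ j < m, S j x = T ∧ S (j + 1) x = T}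
  have hmem : ∀ j x U, x ∈ A → U ∈ S j x → x ∈ U := by
    intro j x U hx hU
    exact hU.2 ⟨mem_closedBall_self (by positivity), hx⟩
  have hfin : ∀ j x, x ∈ A → (S j x).Finite ∧ (S j x).ncard ≤ m := by
    intro j x hx
    have h1 : (S j x).encard ≤ m :=
      (encard_le_encard (fun U hU => (⟨hU.1, hmem j x U hx hU⟩ : U ∈ {U ∈ 𝒰 | x ∈ U}))).trans (hord x hx)
    have h2 : (S j x).Finite := Set.finite_of_encard_le_coe h1
    refine ⟨h2, ?_⟩
    rw [← h2.cast_ncard_eq] at h1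
    exact_mod_cast h1
  have hanti : ∀ i j x, i ≤ j → S j x ⊆ S i x := by
    intro i j x hij U hU
    refine ⟨hU.1, fun y hy => hU.2 ⟨?_, hy.2⟩⟩
    refine closedBall_subset_closedBall ?_ hy.1
    have : (i : ℝ) ≤ j := by exact_mod_cast hij
    gcongr
  have hshift : ∀ j x y, dist x y ≤ δ → S (j + 1) y ⊆ S j x := by
    intro j x y hxy U hU
    refine ⟨hU.1, fun z hz => hU.2 ⟨?_, hz.2⟩⟩
    have h1 : dist z x ≤ j * δ := hz.1
    rw [mem_closedBall]
    push_cast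
    have := dist_triangle z x y
    linarith
  have key : ∀ (x y : X) (j j' : ℕ) (T T' : Set (Set X)), T.Finite → T.ncard = T'.ncard →
      dist x y ≤ δ → j ≤ j' → S j x = T → S (j' + 1) y = T' → T' = T := by
    intro x y j j' T T' hT hc hxy hjj h1 h2
    have h3 : T' ⊆ T := by
      rw [← h1, ← h2]
      exact (hshift j' x y hxy).trans (hanti j j' x hjj)
    exact Set.eq_of_subset_of_ncard_le h3 hc.le hT
  refine ⟨fun c => {Q | ∃ T : Set (Set X), T.Finite ∧ T.ncard = c + 1 ∧ Q = P T}, ?_, ?_, ?_⟩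
  · rintro c _ ⟨T, hT, hTc, rfl⟩ _ ⟨T', hT', hTc', rfl⟩ hne x ⟨hxA, j, hj, hx1, hx2⟩
      y ⟨hyA, j', hj', hy1, hy2⟩
    by_contra hlt
    push Not at hlt
    apply hne
    rcases le_total j j' with h | h
    · rw [key x y j j' T T' hT (by omega) hlt.le h hx1 hy2]
    · rw [key y x j' j T' T hT' (by omega) (by rw [dist_comm]; exact hlt.le) h hy1 hx2]
  · rintro c _ ⟨T, hT, hTc, rfl⟩ x ⟨hxA, j, hj, hx1, hx2⟩ y ⟨hyA, j', hj', hy1, hy2⟩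
    have : T.Nonempty := by
      apply Set.nonempty_of_ncard_ne_zero
      omega
    obtain ⟨U, hU⟩ := this
    have hUx : U ∈ S j x := by rw [hx1]; exact hU
    have hUy : U ∈ S j' y := by rw [hy1]; exact hU
    exact hD U hUx.1 x (hmem _ _ _ hxA hUx) y (hmem _ _ _ hyA hUy)
  · intro x hx
    obtain ⟨U, hU, hUb⟩ := hleb x hx
    have hUm : U ∈ S m x := ⟨hU, hUb⟩
    have hpig : ∃ j < m, S j x = S (j + 1) x := by
      by_contra hcon
      push Not at hcon
      have hind : ∀ j ≤ m, (S j x).ncard + j ≤ m := by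
        intro j
        induction j with
        | zero => intro _; exact (hfin 0 x hx).2
        | succ k ih =>
          intro hk
          have h1 := ih (by omega)
          have h2 : (S (k + 1) x).ncard < (S k x).ncard := by
            apply Set.ncard_lt_ncard _ (hfin k x hx).1
            exact (hanti k (k + 1) x (by omega)).ssubset_of_ne (hcon k (by omega)).symm
          omega
      have h1 := hind m le_rfl
      have h2 : 0 < (S m x).ncard := (Set.ncard_pos (hfin m x hx).1).2 ⟨U, hUm⟩
      omega
    obtain ⟨j, hj, hje⟩ := hpig
    have h2 : 0 < (S j x).ncard :=
      (Set.ncard_pos (hfin j x hx).1).2 ⟨U, hanti j m x hj.le hUm⟩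
    have h3 := (hfin j x hx).2
    refine ⟨⟨(S j x).ncard - 1, by omega⟩, P (S j x), ⟨S j x, (hfin j x hx).1, ?_, rfl⟩, ?_⟩
    · show _ = (S j x).ncard - 1 + 1
      omega
    · exact ⟨hx, j, hj, rfl, hje.symm⟩

lemma encard_le_of_coverOrdLE {X : Type*} (𝒰 : Set (Set X)) (m : ℕ) (h : CoverOrdLE 𝒰 m)
    (x : X) : {U ∈ 𝒰 | x ∈ U}.encard ≤ m := by
  by_contra hcon
  push Not at hcon
  have h1 : ((m + 1 : ℕ) : ℕ∞) ≤ {U ∈ 𝒰 | x ∈ U}.encard := by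
    push_cast
    exact Order.add_one_le_of_lt hcon
  obtain ⟨T, hT, hTc⟩ := Set.exists_subset_encard_eq h1
  have hTf : T.Finite := Set.finite_of_encard_eq_coe hTc
  have h2 := h hTf.toFinset (by
    intro U hU
    exact (hT (by simpa using hU)).1) ⟨x, by
    intro U hU
    exact (hT (by simpa using hU)).2⟩
  rw [hTf.encard_eq_coe_toFinset_card] at hTc
  have : hTf.toFinset.card = m + 1 := by exact_mod_cast hTc
  omega

lemma encard_le_of_listing {X : Type*} (𝒰 : Set (Set X)) (m : ℕ) (x : X)
    (F : Fin m → Set X) (hF : ∀ U ∈ 𝒰, x ∈ U → ∃ k, F k = U) :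
    {U ∈ 𝒰 | x ∈ U}.encard ≤ m := by
  calc {U ∈ 𝒰 | x ∈ U}.encard ≤ (Set.range F).encard :=
        encard_le_encard (fun U hU => hF U hU.1 hU.2)
    _ = (F '' Set.univ).encard := by rw [Set.image_univ]
    _ ≤ (Set.univ : Set (Fin m)).encard := Set.encard_image_le _ _
    _ = m := by simp

theorem asdimLE_of_partition {X : Type*} [MetricSpace X]
    (hgeo : IsGeodesicSpace X) (n : ℕ) (hn : 1 ≤ n)
    (h : ∀ R : ℝ, 0 < R → ∃ d : ℝ, 0 < d ∧ ∃ W : ℕ → Set X,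
      (⋃ i, W i) = Set.univ ∧
      (∀ i j, i ≠ j → interior (W i) ∩ interior (W j) = ∅) ∧
      AsdimUnifLE W n ∧
      ∃ 𝒰 : Set (Set X),
        IsRDCoverOn (⋃ i, frontier (W i)) R d 𝒰 ∧ CoverOrdLE 𝒰 ((n - 1) + 1)) :
    AsdimLE (fun x y : X => dist x y) n := by
  intro r hr
  obtain ⟨L, hLdef⟩ : ∃ L : ℝ, L = (n + 1) * r + 1 := ⟨_, rfl⟩
  have hL : 0 < L := by rw [hLdef]; positivity
  obtain ⟨ρ, hρdef⟩ : ∃ ρ : ℝ, ρ = (2 * n + 2) * L := ⟨_, rfl⟩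
  have hρ : 0 < ρ := by rw [hρdef]; positivity
  have hn0 : (0 : ℝ) < n := by exact_mod_cast hn
  obtain ⟨D, hD, W, hWcov, hWint, hWas, 𝒜, ⟨h𝒜A, -, h𝒜D, h𝒜L⟩, h𝒜ord⟩ :=
    h (n * (2 * ρ)) (by positivity)
  obtain ⟨A, hA⟩ : ∃ A : Set X, A = ⋃ i, frontier (W i) := ⟨_, rfl⟩
  rw [← hA] at h𝒜A h𝒜L
  have hnn : n - 1 + 1 = n := by omega
  rw [hnn] at h𝒜ord
  have hWmem : ∀ x, ∃ i, x ∈ W i := by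
    intro x
    have : x ∈ ⋃ i, W i := by rw [hWcov]; trivial
    simpa using this
  -- the colouring of the boundary
  obtain ⟨𝒱, h𝒱dis, h𝒱D, h𝒱cov⟩ := colorize A 𝒜 n (2 * ρ) D (by positivity) h𝒜D
    (fun x _ => encard_le_of_coverOrdLE 𝒜 n h𝒜ord x) (by
      intro x hx
      have h1 := lt_of_lt_of_le h𝒜L (iInf₂_le x hx)
      simp only [lt_iSup_iff] at h1
      obtain ⟨U, hU, h2⟩ := h1
      refine ⟨U, hU, fun y hy => ?_⟩
      by_contra hyU
      have h3 : infEDist x (A \ U) ≤ edist x y := infEDist_le_edist_of_mem ⟨hy.2, hyU⟩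
      have h4 : edist x y ≤ ENNReal.ofReal (n * (2 * ρ)) := by
        rw [edist_dist]
        apply ENNReal.ofReal_le_ofReal
        rw [dist_comm]
        exact hy.1
      exact absurd h2 (not_lt.2 (h3.trans h4)))
  rcases A.eq_empty_or_nonempty with hAe | hAne
  · -- no boundary: `X` is a single piece
    obtain ⟨E, hE⟩ := hWas r hr
    rcases isEmpty_or_nonempty X with hX | ⟨⟨x0⟩⟩
    · exact ⟨fun _ => ∅, 0, by simp, by simp, fun x => (hX.false x).elim⟩
    obtain ⟨i, hi⟩ := hWmem x0
    obtain ⟨𝒰, -, h1, h2, h3⟩ := hE i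
    refine ⟨𝒰, E, h1, h2, fun x => ?_⟩
    have hx : x ∈ W i := by
      by_contra hx
      obtain ⟨z, hz, -⟩ := frontier_on_geodesic hgeo (W i) x0 x hi hx
      have : z ∈ A := by rw [hA]; exact mem_iUnion.2 ⟨i, hz⟩
      rw [hAe] at this
      exact this
    simpa using h3 hx
  obtain ⟨M, hMdef⟩ : ∃ M : ℝ, M = D + 2 * ρ + L := ⟨_, rfl⟩
  obtain ⟨E, hE⟩ := hWas (2 * M) (by rw [hMdef]; positivity)
  choose 𝒰 h𝒰W h𝒰dis h𝒰E h𝒰cov using hE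
  let H : X → ℝ := fun x => infDist x A
  have hHlip : ∀ x y, H x ≤ H y + dist x y := fun x y => infDist_le_infDist_add_dist
  have hHnn : ∀ x, 0 ≤ H x := fun x => infDist_nonneg
  have hball : ∀ x y i, x ∈ W i → dist x y < H x → y ∈ W i := by
    intro x y i hx hxy
    by_contra hy
    obtain ⟨z, hz, hzd⟩ := frontier_on_geodesic hgeo (W i) x y hx hy
    have hzA : z ∈ A := by rw [hA]; exact mem_iUnion.2 ⟨i, hz⟩
    have : H x ≤ dist x z := infDist_le_dist_of_mem hzA
    linarith
  have huniq : ∀ x i j, 0 < H x → x ∈ W i → x ∈ W j → i = j := by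
    intro x i j hx hi hj
    have hxA : x ∉ A := by
      intro hxA
      have : H x = 0 := infDist_zero_of_mem hxA
      linarith
    have hint : ∀ k, x ∈ W k → x ∈ interior (W k) := by
      intro k hk
      by_contra hcon
      apply hxA
      rw [hA]
      exact mem_iUnion.2 ⟨k, subset_closure hk, hcon⟩
    by_contra hij
    have : x ∈ interior (W i) ∩ interior (W j) := ⟨hint i hi, hint j hj⟩
    rw [hWint i j hij] at this
    exact this
  have hτ : ∀ (V : Set X) (i : ℕ), ∃ U : Set X,
      (∃ y ∈ W i, ∃ v ∈ V, dist y v < ρ) →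
        (∃ k, U ∈ 𝒰 i k) ∧ ∃ y ∈ U, ∃ v ∈ V, dist y v < ρ := by
    intro V i
    by_cases hc : ∃ y ∈ W i, ∃ v ∈ V, dist y v < ρ
    · obtain ⟨y, hy, hv⟩ := hc
      have := h𝒰cov i hy
      simp only [mem_iUnion, mem_sUnion] at this
      obtain ⟨k, U, hU, hyU⟩ := this
      exact ⟨U, fun _ => ⟨⟨k, hU⟩, y, hyU, hv⟩⟩
    · exact ⟨∅, fun hc' => absurd hc' hc⟩
  choose τ hτ using hτ
  let O : Fin n → Set X → Set X := fun c V =>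
    {y | (∃ v ∈ V, dist y v < ρ) ∧ H y < 2 * L * ((c : ℕ) + 1)}
  let G : ℕ → Set X → Set X := fun i U =>
    {y | y ∈ W i ∧ (((∃ u ∈ U, dist y u < M) ∧ 2 * L * n < H y) ∨
      ∃ c : Fin n, ∃ V ∈ 𝒱 c, τ V i = U ∧ (∃ v ∈ V, dist y v < ρ) ∧ 2 * L * (c : ℕ) < H y)}
  have hGM : ∀ i U y, y ∈ G i U → ∃ u ∈ U, dist y u < M := by
    rintro i U y ⟨hyW, ⟨h1, -⟩ | ⟨c, V, hV, rfl, ⟨v, hv, hyv⟩, -⟩⟩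
    · exact h1
    · obtain ⟨-, u, hu, v', hv', huv⟩ := hτ V i ⟨y, hyW, v, hv, hyv⟩
      refine ⟨u, hu, ?_⟩
      have h1 := h𝒱D c V hV v hv v' hv'
      have h2 := dist_triangle4 y v v' u
      rw [dist_comm v' u] at h2
      linarith
  have hGH : ∀ i U y, y ∈ G i U → 0 < H y := by
    rintro i U y ⟨hyW, ⟨-, h1⟩ | ⟨c, V, hV, -, -, h1⟩⟩
    · exact lt_of_le_of_lt (by positivity) h1
    · exact lt_of_le_of_lt (by positivity) h1
  obtain ⟨𝒪, h𝒪⟩ : ∃ 𝒪 : Set (Set X), 𝒪 = {Q | (∃ c, ∃ V ∈ 𝒱 c, Q = O c V) ∨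
      ∃ i k, ∃ U ∈ 𝒰 i k, Q = G i U} := ⟨_, rfl⟩
  have hVuniq : ∀ (x : X) (c : Fin n), ∃ V₀ : Set X, ∀ V ∈ 𝒱 c, (∃ v ∈ V, dist x v < ρ) →
      V = V₀ := by
    intro x c
    by_cases hc : ∃ V ∈ 𝒱 c, ∃ v ∈ V, dist x v < ρ
    · obtain ⟨V₀, hV₀, v₀, hv₀, hx₀⟩ := hc
      refine ⟨V₀, fun V hV ⟨v, hv, hx⟩ => ?_⟩
      by_contra hne
      have h1 := h𝒱dis c V hV V₀ hV₀ hne v hv v₀ hv₀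
      have h2 := dist_triangle_left v v₀ x
      linarith
    · exact ⟨∅, fun V hV hx => absurd ⟨V, hV, hx⟩ hc⟩
  have hUuniq : ∀ (x : X) (i : ℕ) (k : Fin (n + 1)), ∃ U₀ : Set X, ∀ U ∈ 𝒰 i k,
      (∃ u ∈ U, dist x u < M) → U = U₀ := by
    intro x i k
    by_cases hc : ∃ U ∈ 𝒰 i k, ∃ u ∈ U, dist x u < M
    · obtain ⟨V₀, hV₀, v₀, hv₀, hx₀⟩ := hc
      refine ⟨V₀, fun V hV ⟨v, hv, hx⟩ => ?_⟩
      by_contra hne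
      have h1 := h𝒰dis i k V hV V₀ hV₀ hne v hv v₀ hv₀
      have h2 := dist_triangle_left v v₀ x
      linarith
    · exact ⟨∅, fun V hV hx => absurd ⟨V, hV, hx⟩ hc⟩
  choose Vx hVx using hVuniq
  choose Ux hUx using hUuniq
  have hord : ∀ x, {Q ∈ 𝒪 | x ∈ Q}.encard ≤ ((n + 1 : ℕ) : ℕ∞) := by
    intro x
    obtain ⟨i, hi⟩ := hWmem x
    rcases lt_or_ge (2 * L * n) (H x) with hH | hH
    · apply encard_le_of_listing 𝒪 (n + 1) x (fun k => G i (Ux x i k))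
      intro Q hQ hxQ
      rw [h𝒪] at hQ
      rcases hQ with ⟨c, V, hV, rfl⟩ | ⟨j, k, U, hU, rfl⟩
      · exfalso
        have h1 : H x < 2 * L * ((c : ℕ) + 1) := hxQ.2
        have h2 : ((c : ℕ) : ℝ) + 1 ≤ n := by exact_mod_cast c.2
        have h3 : 2 * L * ((c : ℕ) + 1) ≤ 2 * L * n := by gcongr
        linarith
      · obtain rfl := huniq x i j (hGH _ _ _ hxQ) hi hxQ.1
        exact ⟨k, by rw [← hUx x i k U hU (hGM _ _ _ hxQ)]⟩
    · have hc : ∃ c : ℕ, c < n ∧ 2 * L * c ≤ H x ∧ H x ≤ 2 * L * (c + 1) := by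
        have hfl : ∃ m : ℕ, H x ≤ 2 * L * ((m : ℝ) + 1) := by
          refine ⟨n, hH.trans ?_⟩
          gcongr
          linarith
        classical
        refine ⟨Nat.find hfl, ?_, ?_, Nat.find_spec hfl⟩
        · have : Nat.find hfl ≤ n - 1 := by
            apply Nat.find_min'
            have : ((n - 1 : ℕ) : ℝ) + 1 = n := by exact_mod_cast hnn
            rw [this]
            exact hH
          omega
        · rcases Nat.eq_zero_or_pos (Nat.find hfl) with h0 | h0
          · rw [h0]; simpa using hHnn x
          · have h1 := Nat.find_min hfl (Nat.sub_lt h0 one_pos)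
            have h2 : ((Nat.find hfl - 1 : ℕ) : ℝ) + 1 = Nat.find hfl := by
              have : Nat.find hfl - 1 + 1 = Nat.find hfl := by omega
              exact_mod_cast this
            rw [h2] at h1
            linarith
      obtain ⟨c, hcn, hc1, hc2⟩ := hc
      apply encard_le_of_listing 𝒪 (n + 1) x (fun k =>
        if hk : (k : ℕ) ≤ c then G i (τ (Vx x ⟨k, by omega⟩) i)
        else O ⟨(k : ℕ) - 1, by omega⟩ (Vx x ⟨(k : ℕ) - 1, by omega⟩))
      intro Q hQ hxQ
      rw [h𝒪] at hQ
      rcases hQ with ⟨c', V, hV, rfl⟩ | ⟨j, k, U, hU, rfl⟩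
      · have h1 : H x < 2 * L * ((c' : ℕ) + 1) := hxQ.2
        have h2 : c < (c' : ℕ) + 1 := by
          have h3 := hc1.trans_lt h1
          have h4 : (c : ℝ) < ((c' : ℕ) : ℝ) + 1 := lt_of_mul_lt_mul_left h3 (by positivity)
          exact_mod_cast h4
        refine ⟨⟨(c' : ℕ) + 1, by omega⟩, ?_⟩
        have h5 : ¬ ((c' : ℕ) + 1 ≤ c) := by omega
        simp only [h5, dif_neg, not_false_eq_true, Nat.add_sub_cancel, Fin.eta]
        rw [← hVx x c' V hV hxQ.1]
      · obtain rfl := huniq x i j (hGH _ _ _ hxQ) hi hxQ.1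
        rcases hxQ.2 with ⟨-, h1⟩ | ⟨c', V, hV, hVU, hxV, h1⟩
        · linarith
        · have h2 : (c' : ℕ) < c + 1 := by
            have h3 := h1.trans_le hc2
            have h4 : ((c' : ℕ) : ℝ) < (c : ℝ) + 1 := lt_of_mul_lt_mul_left h3 (by positivity)
            exact_mod_cast h4
          refine ⟨⟨(c' : ℕ), by omega⟩, ?_⟩
          have h5 : (c' : ℕ) ≤ c := by omega
          simp only [h5, dif_pos, Fin.eta]
          rw [← hVx x c' V hV hxV, hVU]
  have hbd : ∀ Q ∈ 𝒪, ∀ x ∈ Q, ∀ y ∈ Q, dist x y ≤ max (D + 2 * ρ) (E + 2 * M) := by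
    intro Q hQ x hx y hy
    rw [h𝒪] at hQ
    rcases hQ with ⟨c, V, hV, rfl⟩ | ⟨i, k, U, hU, rfl⟩
    · apply le_max_of_le_left
      obtain ⟨⟨v, hv, hxv⟩, -⟩ := hx
      obtain ⟨⟨v', hv', hyv⟩, -⟩ := hy
      have h1 := h𝒱D c V hV v hv v' hv'
      have h2 := dist_triangle4 x v v' y
      rw [dist_comm v' y] at h2
      linarith
    · apply le_max_of_le_right
      obtain ⟨v, hv, hxv⟩ := hGM _ _ _ hx
      obtain ⟨v', hv', hyv⟩ := hGM _ _ _ hy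
      have h1 := h𝒰E i k U hU v hv v' hv'
      have h2 := dist_triangle4 x v v' y
      rw [dist_comm v' y] at h2
      linarith
  have hleb : ∀ x, ∃ Q ∈ 𝒪, ball x L ⊆ Q := by
    intro x
    obtain ⟨i, hi⟩ := hWmem x
    rcases le_or_gt (2 * L * n + L) (H x) with hH | hH
    · have := h𝒰cov i hi
      simp only [mem_iUnion, mem_sUnion] at this
      obtain ⟨k, U, hU, hxU⟩ := this
      refine ⟨G i U, by rw [h𝒪]; exact Or.inr ⟨i, k, U, hU, rfl⟩, fun y hy => ?_⟩
      have hyx : dist y x < L := hy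
      have hxy : dist x y < L := by rwa [dist_comm]
      have hpos : 0 ≤ 2 * L * n := by positivity
      refine ⟨hball x y i hi (by linarith), Or.inl ⟨⟨x, hxU, by linarith⟩, ?_⟩⟩
      have := hHlip x y
      linarith
    · obtain ⟨a, haA, hxa⟩ := (infDist_lt_iff hAne).1 hH
      obtain ⟨c, V, hV, haV⟩ := h𝒱cov a haA
      have hnear : ∀ y ∈ ball x L, ∃ v ∈ V, dist y v < ρ := by
        intro y hy
        have hyx : dist y x < L := hy
        refine ⟨a, haV, ?_⟩
        have := dist_triangle y x a
        rw [hρdef]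
        linarith
      rcases le_or_gt (H x) (2 * L * (c : ℕ) + L) with hHc | hHc
      · refine ⟨O c V, by rw [h𝒪]; exact Or.inl ⟨c, V, hV, rfl⟩, fun y hy => ⟨hnear y hy, ?_⟩⟩
        have hyx : dist y x < L := hy
        have := hHlip y x
        linarith
      · obtain ⟨⟨k, hk⟩, -⟩ := hτ V i ⟨x, hi, hnear x (mem_ball_self hL)⟩
        refine ⟨G i (τ V i), by rw [h𝒪]; exact Or.inr ⟨i, k, _, hk, rfl⟩, fun y hy => ?_⟩
        have hyx : dist y x < L := hy
        have hxy : dist x y < L := by rwa [dist_comm]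
        have hpos : 0 ≤ 2 * L * (c : ℕ) := by positivity
        refine ⟨hball x y i hi (by linarith), Or.inr ⟨c, V, hV, rfl, hnear y hy, ?_⟩⟩
        have := hHlip x y
        linarith
  obtain ⟨𝒲, h1, h2, h3⟩ := colorize Set.univ 𝒪 (n + 1) r _ hr hbd (fun x _ => hord x) (by
    intro x _
    obtain ⟨Q, hQ, hb⟩ := hleb x
    refine ⟨Q, hQ, fun y hy => hb ?_⟩
    have h1 : dist y x ≤ ((n + 1 : ℕ) : ℝ) * r := hy.1
    push_cast at h1
    rw [mem_ball]
    linarith)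
  exact ⟨𝒲, _, h1, h2, fun x => h3 x trivial⟩
end

section
/- Let A and B be finitely generated groups with a common subgroup C, and suppose asdim A ≤ n and asdim B ≤ n. Then for every m ∈ ℕ, asdim((AB)^m) ≤ n, where (AB)^m = {a₁b₁a₂b₂⋯a_m b_m : aᵢ ∈ A, bᵢ ∈ B} ⊆ A *_C B carries the metric restricted from the word metric of A *_C B. -/
/-- `G` is the amalgamated free product `A *_C B` of its subgroups `A` and `B`
over the common subgroup `C`: `A` and `B` generate `G`, and any pair of
homomorphisms on `A` and `B` agreeing on `C` extends to `G` (this universal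
property, together with the generation condition, characterizes `A *_C B`). -/
def IsAmalgamatedProduct (G : Type*) [Group G] (A B C : Subgroup G) : Prop :=
  C ≤ A ∧ C ≤ B ∧ Subgroup.closure ((A : Set G) ∪ (B : Set G)) = ⊤ ∧
  ∀ {H : Type*} [Group H] (fA : A →* H) (fB : B →* H),
    (∀ (x : G) (hxA : x ∈ A) (hxB : x ∈ B), x ∈ C → fA ⟨x, hxA⟩ = fB ⟨x, hxB⟩) →
    ∃ f : G →* H, (∀ a : A, f ↑a = fA a) ∧ (∀ b : B, f ↑b = fB b)

namespace AsdimAB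

open Monoid

universe u v

/-- The two factors, indexed by `Bool`. -/
def fam {G : Type u} [Group G] (A B : Subgroup G) (b : Bool) : Subgroup G := cond b A B

/-- `W F C j k g`: `g` has a reduced expression with `k` letters, the last one of type `j`. -/
inductive W {G : Type u} [Group G] (F : Bool → Subgroup G) (C : Subgroup G) :
    Bool → ℕ → G → Prop
  | nil (j : Bool) (c : G) (hc : c ∈ C) : W F C j 0 c
  | step (j : Bool) (k : ℕ) (g s : G) (h : W F C j k g) (hs : s ∈ F (!j)) (hsC : s ∉ C) :
      W F C (!j) (k + 1) (g * s)

/-- Elements in the branch `x · F i · …`. -/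
inductive Br {G : Type u} [Group G] (F : Bool → Subgroup G) (C : Subgroup G) (x : G) (i : Bool) :
    Bool → ℕ → G → Prop
  | one (s : G) (hs : s ∈ F i) (hsC : s ∉ C) : Br F C x i i 0 (x * s)
  | step (j : Bool) (k : ℕ) (g s : G) (h : Br F C x i j k g) (hs : s ∈ F (!j)) (hsC : s ∉ C) :
      Br F C x i (!j) (k + 1) (g * s)

section alg

variable {G : Type u} [Group G] {F : Bool → Subgroup G} {C : Subgroup G}

lemma W.mulC (hC : ∀ i, C ≤ F i) {j k g c} (h : W F C j k g) (hc : c ∈ C) :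
    W F C j k (g * c) := by
  cases h with
  | nil _ _ h => exact .nil _ _ (C.mul_mem h hc)
  | step j k g s h hs hsC =>
    rw [mul_assoc]
    exact .step _ _ _ _ h (mul_mem hs (hC _ hc)) (by rwa [C.mul_mem_cancel_right hc])

lemma Br.mulC (hC : ∀ i, C ≤ F i) {x i j k g c} (h : Br F C x i j k g) (hc : c ∈ C) :
    Br F C x i j k (g * c) := by
  cases h with
  | one s hs hsC =>
    rw [mul_assoc]
    exact .one _ (mul_mem hs (hC _ hc)) (by rwa [C.mul_mem_cancel_right hc])
  | step j k g s h hs hsC =>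
    rw [mul_assoc]
    exact .step _ _ _ _ h (mul_mem hs (hC _ hc)) (by rwa [C.mul_mem_cancel_right hc])

lemma Br.toW {x i j k n g} (hx : W F C (!i) k x) (h : Br F C x i j n g) :
    W F C j (k + n + 1) g := by
  induction h with
  | one s hs hsC =>
    have := W.step _ _ _ s hx (by simpa using hs) hsC
    simpa using this
  | step j n g s h hs hsC ih => exact .step _ _ _ _ ih hs hsC

lemma W.mulF (hC : ∀ i, C ≤ F i) {j k g i s} (h : W F C j k g) (hs : s ∈ F i) :
    ∃ j' k', k' ≤ k + 1 ∧ W F C j' k' (g * s) := by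
  by_cases hsC : s ∈ C
  · exact ⟨j, k, by omega, h.mulC hC hsC⟩
  by_cases hij : i = !j
  · subst hij
    exact ⟨!j, k + 1, le_rfl, .step _ _ _ _ h hs hsC⟩
  have hij : i = j := by revert hij; cases i <;> cases j <;> simp
  subst hij
  cases h with
  | nil _ _ h => 
    exact ⟨i, 1, by omega, by simpa using W.step (!i) 0 g s (.nil _ _ h) (by simpa using hs) hsC⟩
  | step j k g t h ht htC =>
    rw [mul_assoc]
    by_cases htsC : t * s ∈ C
    · exact ⟨j, k, by omega, h.mulC hC htsC⟩
    · exact ⟨_, k + 1, by omega, .step _ _ _ _ h (mul_mem ht hs) htsC⟩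

lemma Br.mulF (hC : ∀ i, C ≤ F i) {x i j k n g i' s} (hx : W F C (!i) k x)
    (h : Br F C x i j n g) (hs : s ∈ F i') :
    (∃ j' n', Br F C x i j' n' (g * s)) ∨ ∃ j', W F C j' k (g * s) := by
  by_cases hsC : s ∈ C
  · exact .inl ⟨j, n, h.mulC hC hsC⟩
  by_cases hij : i' = !j
  · subst hij
    exact .inl ⟨_, _, .step _ _ _ _ h hs hsC⟩
  have hij : i' = j := by revert hij; cases i' <;> cases j <;> simp
  subst hij
  cases h with
  | one t ht htC =>
    rw [mul_assoc]
    by_cases htsC : t * s ∈ C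
    · exact .inr ⟨_, hx.mulC hC htsC⟩
    · exact .inl ⟨_, _, .one _ (mul_mem ht hs) htsC⟩
  | step j k g t h ht htC =>
    rw [mul_assoc]
    by_cases htsC : t * s ∈ C
    · exact .inl ⟨_, _, h.mulC hC htsC⟩
    · exact .inl ⟨_, _, .step _ _ _ _ h (mul_mem ht hs) htsC⟩

/-- the map of the base into the factors -/
abbrev phi (hC : ∀ i, C ≤ F i) (i : Bool) : C →* F i := Subgroup.inclusion (hC i)

lemma W.exists_word (hC : ∀ i, C ≤ F i) (f : G →* PushoutI (phi hC))
    (hf : ∀ i (a : F i), f a = PushoutI.of i a) {j k g} (h : W F C j (k + 1) g) :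
    ∃ w : CoprodI.Word (fun i => F i), PushoutI.Reduced (phi hC) w ∧
      PushoutI.ofCoprodI w.prod = f g ∧ w.toList.length = k + 1 ∧
      (w.toList.map Sigma.fst).getLast? = some j := by
  induction k generalizing j g with
  | zero =>
    rcases h with _ | ⟨j, _, g, s, h, hs, hsC⟩
    cases h with
    | nil _ _ hc =>
      have hgs : g * s ∈ F (!j) := mul_mem (hC _ hc) hs
      have hgsC : g * s ∉ C := by rwa [C.mul_mem_cancel_left hc]
      refine ⟨⟨[⟨!j, ⟨g * s, hgs⟩⟩], ?_, by simp⟩, ?_, ?_, by simp, by simp⟩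
      · simp only [List.mem_singleton, forall_eq]
        intro h
        apply hgsC
        have := congrArg Subtype.val h
        simp only [Subgroup.coe_one] at this
        rw [this]; exact one_mem _
      · intro a ha
        simp only [List.mem_singleton] at ha
        subst ha
        rintro ⟨c, hc⟩
        apply hgsC
        have := congrArg Subtype.val hc
        simp at this
        rw [← this]; exact c.2
      · simp [CoprodI.Word.prod, ← hf]
  | succ k ih =>
    rcases h with _ | ⟨j, _, g, s, h, hs, hsC⟩
    obtain ⟨w, hw, hp, hl, ht⟩ := ih h
    refine ⟨⟨w.toList ++ [⟨!j, ⟨s, hs⟩⟩], ?_, ?_⟩, ?_, ?_, by simp [hl], by simp⟩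
    · intro a ha
      rcases List.mem_append.1 ha with ha | ha
      · exact w.ne_one a ha
      · simp only [List.mem_singleton] at ha
        subst ha
        intro h
        apply hsC
        have := congrArg Subtype.val h
        simp only [Subgroup.coe_one] at this
        rw [this]; exact one_mem _
    · rw [List.isChain_append]
      refine ⟨w.chain_ne, by simp, ?_⟩
      intro a ha b hb
      simp only [List.head?_cons, Option.mem_def, Option.some.injEq] at hb
      subst hb
      rw [List.getLast?_map, Option.mem_def.1 ha] at ht
      simp at ht
      simp [ht]
    · intro a ha
      rcases List.mem_append.1 ha with ha | ha
      · exact hw a ha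
      · simp only [List.mem_singleton] at ha
        subst ha
        rintro ⟨c, hc⟩
        apply hsC
        have := congrArg Subtype.val hc
        simp at this
        rw [← this]; exact c.2
    · rw [map_mul, ← hp]
      simp [CoprodI.Word.prod, ← hf]

lemma W.unique (hC : ∀ i, C ≤ F i) (f : G →* PushoutI (phi hC))
    (hf : ∀ i (a : F i), f a = PushoutI.of i a) {j k g j' k'} (h : W F C j k g)
    (h' : W F C j' k' g) : k = k' ∧ (0 < k → j = j') := by
  have hinj : ∀ i, Function.Injective (phi hC i) := fun i => Subgroup.inclusion_injective _
  have key : ∀ {g j k}, g ∈ C → W F C j (k + 1) g → False := by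
    intro g j k hg h
    obtain ⟨w, hw, hp, hl, ht⟩ := h.exists_word hC f hf
    have := hw.eq_empty_of_mem_range hinj (by
      rw [hp]
      refine ⟨⟨g, hg⟩, ?_⟩
      rw [← PushoutI.of_apply_eq_base (phi hC) true, ← hf]
      simp)
    rw [this] at hl
    simp [CoprodI.Word.empty] at hl
  cases k with
  | zero =>
    cases k' with
    | zero => simp
    | succ k' =>
      cases h with
      | nil _ _ hc => exact (key hc h').elim
  | succ k =>
    cases k' with
    | zero =>
      cases h' with
      | nil _ _ hc => exact (key hc h).elim
    | succ k' =>
      obtain ⟨d⟩ := PushoutI.NormalWord.transversal_nonempty (phi hC) hinj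
      obtain ⟨w, hw, hp, hl, ht⟩ := h.exists_word hC f hf
      obtain ⟨w', hw', hp', hl', ht'⟩ := h'.exists_word hC f hf
      obtain ⟨v, hv, hvm⟩ := hw.exists_normalWord_prod_eq d
      obtain ⟨v', hv', hvm'⟩ := hw'.exists_normalWord_prod_eq d
      have : v = v' := PushoutI.NormalWord.prod_injective (by rw [hv, hv', hp, hp'])
      subst this
      rw [hvm] at hvm'
      constructor
      · have := congrArg List.length hvm'
        simpa [hl, hl'] using this
      · intro _
        rw [hvm', ht'] at ht
        simpa using ht.symm

end alg

lemma exists_list {G : Type u} [Group G] {S : Set G} (hS : ∀ s ∈ S, s⁻¹ ∈ S) {g : G}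
    (hg : g ∈ Subgroup.closure S) : ∃ l : List G, (∀ x ∈ l, x ∈ S) ∧ l.prod = g := by
  rw [← Subgroup.mem_toSubmonoid, Subgroup.closure_toSubmonoid] at hg
  have : S ∪ S⁻¹ = S := by
    apply Set.union_eq_left.2
    intro s hs
    simpa using hS _ (Set.mem_inv.1 hs)
  rw [this] at hg
  exact Submonoid.exists_list_of_mem_closure hg

lemma closure_countable {G : Type u} [Group G] {S : Set G} (hS : ∀ s ∈ S, s⁻¹ ∈ S)
    (hfin : S.Finite) : Countable (Subgroup.closure S) := by
  have : Countable S := hfin.countable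
  have hr : (Subgroup.closure S : Set G) ⊆
      Set.range (fun l : List S => (l.map Subtype.val).prod) := by
    intro g hg
    obtain ⟨l, hl, rfl⟩ := exists_list hS hg
    refine ⟨l.attach.map (fun x => ⟨x.1, hl _ x.2⟩), ?_⟩
    simp
  exact ((Set.countable_range _).mono hr).to_subtype

lemma exists_hom {G : Type u} [Group G] (A B C : Subgroup G)
    (hG : IsAmalgamatedProduct.{u, v} G A B C) [Countable A] [Countable B]
    (hC : ∀ i, C ≤ fam A B i) :
    ∃ f : G →* PushoutI (phi hC), ∀ i (a : fam A B i), f a = PushoutI.of i a := by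
  have h1 : ∀ i, Countable (fam A B i) := by
    intro i; cases i
    · exact ‹Countable B›
    · exact ‹Countable A›
  have h2 : Countable C := (Subgroup.inclusion_injective (hC true)).countable
  have hcon : Countable (PushoutI (phi hC)) := by
    have : Countable (FreeMonoid (Σ i, fam A B i)) :=
      inferInstanceAs (Countable (List (Σ i, fam A B i)))
    have : Countable (CoprodI (fun i => fam A B i)) :=
      (Con.mk'_surjective (c := conGen (CoprodI.Rel (fun i => fam A B i)))).countable
    have : Countable (FreeMonoid (CoprodI (fun i => fam A B i) ⊕ C)) :=
      inferInstanceAs (Countable (List (CoprodI (fun i => fam A B i) ⊕ C)))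
    have : Countable (Monoid.Coprod (CoprodI (fun i => fam A B i)) C) :=
      (Coprod.mk_surjective).countable
    exact (Con.mk'_surjective (c := PushoutI.con (phi hC))).countable
  have : Small.{v} (PushoutI (phi hC)) := Countable.toSmall _
  let e : PushoutI (phi hC) ≃* Shrink.{v} (PushoutI (phi hC)) := (Shrink.mulEquiv).symm
  obtain ⟨f, hfA, hfB⟩ := hG.2.2.2 (H := Shrink.{v} (PushoutI (phi hC)))
    (e.toMonoidHom.comp (PushoutI.of (φ := phi hC) true : A →* _))
    (e.toMonoidHom.comp (PushoutI.of (φ := phi hC) false : B →* _)) (by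
      intro x hA hB hx
      have h1 := PushoutI.of_apply_eq_base (phi hC) true ⟨x, hx⟩
      have h2 := PushoutI.of_apply_eq_base (phi hC) false ⟨x, hx⟩
      exact congrArg e (h1.trans h2.symm))
  refine ⟨e.symm.toMonoidHom.comp f, ?_⟩
  intro i a
  cases i
  · have := hfB a
    simp only [MonoidHom.comp_apply, this]
    exact e.symm_apply_apply _
  · have := hfA a
    simp only [MonoidHom.comp_apply, this]
    exact e.symm_apply_apply _

section metric

variable {G : Type u} [Group G]

lemma wordNorm_le {S : Set G} (l : List G) (hl : ∀ x ∈ l, x ∈ S) :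
    wordNorm S l.prod ≤ l.length :=
  Nat.sInf_le ⟨l, rfl, hl, rfl⟩

lemma wordNorm_attained {S : Set G} (hS : ∀ s ∈ S, s⁻¹ ∈ S) {g : G}
    (hg : g ∈ Subgroup.closure S) :
    ∃ l : List G, l.length = wordNorm S g ∧ (∀ x ∈ l, x ∈ S) ∧ l.prod = g := by
  obtain ⟨l, hl, hp⟩ := exists_list hS hg
  exact Nat.sInf_mem (s := {k : ℕ | ∃ l : List G, l.length = k ∧ (∀ x ∈ l, x ∈ S) ∧ l.prod = g})
    ⟨l.length, l, rfl, hl, hp⟩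

lemma wordNorm_mul {S : Set G} (hS : ∀ s ∈ S, s⁻¹ ∈ S) (hgen : Subgroup.closure S = ⊤)
    (g h : G) : wordNorm S (g * h) ≤ wordNorm S g + wordNorm S h := by
  obtain ⟨l, h1, h2, rfl⟩ := wordNorm_attained hS (g := g) (by simp [hgen])
  obtain ⟨l', h1', h2', rfl⟩ := wordNorm_attained hS (g := h) (by simp [hgen])
  rw [← h1, ← h1', ← List.prod_append, ← List.length_append]
  apply wordNorm_le
  intro x hx
  rcases List.mem_append.1 hx with hx | hx
  · exact h2 x hx
  · exact h2' x hx

lemma wordNorm_inv_le {S : Set G} (hS : ∀ s ∈ S, s⁻¹ ∈ S) (hgen : Subgroup.closure S = ⊤)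
    (g : G) : wordNorm S g⁻¹ ≤ wordNorm S g := by
  obtain ⟨l, h1, h2, rfl⟩ := wordNorm_attained hS (g := g) (by simp [hgen])
  rw [← h1, List.prod_inv_reverse]
  refine (wordNorm_le _ ?_).trans (by simp)
  intro x hx
  simp only [List.mem_reverse, List.mem_map] at hx
  obtain ⟨y, hy, rfl⟩ := hx
  exact hS _ (h2 y hy)

lemma wordDist_self (S : Set G) (g : G) : wordDist S g g = 0 := by
  have := wordNorm_le (S := S) [] (by simp)
  simp only [List.prod_nil, List.length_nil] at this
  simp only [wordDist, inv_mul_cancel, Nat.cast_eq_zero]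
  omega

lemma wordDist_comm {S : Set G} (hS : ∀ s ∈ S, s⁻¹ ∈ S) (hgen : Subgroup.closure S = ⊤)
    (g h : G) : wordDist S g h = wordDist S h g := by
  have key : ∀ g h : G, wordDist S g h ≤ wordDist S h g := by
    intro g h
    have := wordNorm_inv_le hS hgen (h⁻¹ * g)
    rw [mul_inv_rev, inv_inv] at this
    unfold wordDist
    exact_mod_cast this
  exact le_antisymm (key _ _) (key _ _)

lemma wordDist_triangle {S : Set G} (hS : ∀ s ∈ S, s⁻¹ ∈ S) (hgen : Subgroup.closure S = ⊤)
    (x y z : G) : wordDist S x z ≤ wordDist S x y + wordDist S y z := by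
  have := wordNorm_mul hS hgen (x⁻¹ * y) (y⁻¹ * z)
  rw [show x⁻¹ * y * (y⁻¹ * z) = x⁻¹ * z by group] at this
  unfold wordDist
  exact_mod_cast this

lemma wordDist_left (S : Set G) (a x y : G) :
    wordDist S (a * x) (a * y) = wordDist S x y := by
  unfold wordDist
  congr 2
  group

lemma ball_finite {S : Set G} (hS : ∀ s ∈ S, s⁻¹ ∈ S) (hfin : S.Finite)
    (hgen : Subgroup.closure S = ⊤) (N : ℕ) : {g : G | wordNorm S g ≤ N}.Finite := by
  have : Finite S := hfin
  refine ((List.finite_length_le S N).image (fun l => (l.map Subtype.val).prod)).subset ?_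
  intro g hg
  obtain ⟨l, h1, h2, rfl⟩ := wordNorm_attained hS (g := g) (by simp [hgen])
  refine ⟨l.attach.map (fun x => ⟨x.1, h2 _ x.2⟩), ?_, ?_⟩
  · simp only [Set.mem_ofPred_eq] at hg
    simp [h1, hg]
  · simp

end metric

section AD

variable {X : Type u}

/-- Colour/label at scale `r` with bound `D`. -/
def Good (d : X → X → ℝ) (Y : Set X) {n : ℕ} {T : Type u} (c : X → Fin (n + 1)) (e : X → T)
    (r D : ℝ) : Prop :=
  ∀ x ∈ Y, ∀ y ∈ Y, c x = c y → (d x y < r → e x = e y) ∧ (e x = e y → d x y ≤ D)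

/-- Asymptotic dimension of a subset, via colourings. -/
def AD (d : X → X → ℝ) (Y : Set X) (n : ℕ) : Prop :=
  ∀ r : ℝ, 0 < r → ∃ (T : Type u) (c : X → Fin (n + 1)) (e : X → T) (D : ℝ), Good d Y c e r D

lemma AD.mono {d : X → X → ℝ} {Y Z : Set X} {n : ℕ} (h : AD d Y n) (hZ : Z ⊆ Y) : AD d Z n := by
  intro r hr
  obtain ⟨T, c, e, D, hg⟩ := h r hr
  exact ⟨T, c, e, D, fun x hx y hy => hg x (hZ hx) y (hZ hy)⟩

lemma AD.nbhd {d : X → X → ℝ} (hsymm : ∀ x y, d x y = d y x)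
    (htri : ∀ x y z, d x z ≤ d x y + d y z) {Y : Set X} {n : ℕ} (h : AD d Y n) (ρ : ℝ)
    (hρ : 0 < ρ) : AD d {x | ∃ y ∈ Y, d x y < ρ} n := by
  intro r hr
  obtain ⟨T, c, e, D, hg⟩ := h (r + 2 * ρ) (by linarith)
  have : ∀ x, ∃ p, (∃ y ∈ Y, d x y < ρ) → p ∈ Y ∧ d x p < ρ := by
    intro x
    by_cases hx : ∃ y ∈ Y, d x y < ρ
    · obtain ⟨y, hy⟩ := hx
      exact ⟨y, fun _ => hy⟩
    · exact ⟨x, fun h => (hx h).elim⟩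
  choose p hp using this
  refine ⟨T, c ∘ p, e ∘ p, D + 2 * ρ, ?_⟩
  intro x hx y hy hc
  obtain ⟨hx1, hx2⟩ := hp x hx
  obtain ⟨hy1, hy2⟩ := hp y hy
  obtain ⟨h1, h2⟩ := hg _ hx1 _ hy1 hc
  constructor
  · intro hd
    apply h1
    have := htri (p x) x (p y)
    have := htri x y (p y)
    have := hsymm (p x) x
    linarith
  · intro he
    have := h2 he
    have := htri x (p x) y
    have := htri (p x) (p y) y
    have := hsymm (p y) y
    linarith

lemma union_good {d : X → X → ℝ} (hself : ∀ x, d x x = 0) (hsymm : ∀ x y, d x y = d y x)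
    (htri : ∀ x y z, d x z ≤ d x y + d y z) {Y Z : Set X} {n : ℕ} {T₁ T₂ : Type u}
    {c₁ c₂ : X → Fin (n + 1)} {e₁ : X → T₁} {e₂ : X → T₂} {r R D : ℝ} (hr : 0 < r) (hR : 0 ≤ R)
    (hZ : Good d Z c₁ e₁ r R) (hY : Good d Y c₂ e₂ (R + 2 * r) D) :
    ∃ (T : Type u) (c : X → Fin (n + 1)) (e : X → T) (D' : ℝ), Good d (Z ∪ Y) c e r D' := by
  classical
  have : ∀ (i : Fin (n + 1)) (t : T₁), ∃ φ : T₂ ⊕ T₁,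
      (∃ z ∈ Z, ∃ y ∈ Y, c₁ z = i ∧ e₁ z = t ∧ c₂ y = i ∧ d z y < r ∧ φ = .inl (e₂ y)) ∨
      ((¬ ∃ z ∈ Z, ∃ y ∈ Y, c₁ z = i ∧ e₁ z = t ∧ c₂ y = i ∧ d z y < r) ∧ φ = .inr t) := by
    intro i t
    by_cases h : ∃ z ∈ Z, ∃ y ∈ Y, c₁ z = i ∧ e₁ z = t ∧ c₂ y = i ∧ d z y < r
    · obtain ⟨z, hz, y, hy, h1, h2, h3, h4⟩ := h
      exact ⟨_, .inl ⟨z, hz, y, hy, h1, h2, h3, h4, rfl⟩⟩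
    · exact ⟨_, .inr ⟨h, rfl⟩⟩
  choose φ hφ using this
  let c : X → Fin (n + 1) := fun x => if x ∈ Y then c₂ x else c₁ x
  let e : X → T₂ ⊕ T₁ := fun x => if x ∈ Y then .inl (e₂ x) else φ (c₁ x) (e₁ x)
  have cY : ∀ x ∈ Y, c x = c₂ x := fun x hx => if_pos hx
  have eY : ∀ x ∈ Y, e x = .inl (e₂ x) := fun x hx => if_pos hx
  have cZ : ∀ x, x ∉ Y → c x = c₁ x := fun x hx => if_neg hx
  have eZ : ∀ x, x ∉ Y → e x = φ (c₁ x) (e₁ x) := fun x hx => if_neg hx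
  have hYZ : ∀ y ∈ Y, ∀ z ∈ Z, z ∉ Y → c y = c z → d y z < r → e y = e z := by
    intro y hy z hz hzY hc hd
    rw [cY y hy, cZ z hzY] at hc
    rw [eY y hy, eZ z hzY]
    rcases hφ (c₁ z) (e₁ z) with ⟨z', hz', y', hy', h1, h2, h3, h4, h5⟩ | ⟨h1, h2⟩
    · rw [h5]
      congr 1
      apply (hY y hy y' hy' (hc.trans h3.symm)).1
      have := (hZ z hz z' hz' h1.symm).2 h2.symm
      have := htri y z y'
      have := htri z z' y'
      linarith
    · exact (h1 ⟨z, hz, y, hy, rfl, rfl, hc, by rwa [hsymm]⟩).elim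
  have hb : ∀ x ∈ Z ∪ Y, ∀ t, e x = .inl t → ∃ y ∈ Y, c₂ y = c x ∧ e₂ y = t ∧ d x y ≤ R + r := by
    intro x hx t ht
    by_cases hxY : x ∈ Y
    · rw [eY x hxY] at ht
      exact ⟨x, hxY, (cY x hxY).symm, by simpa using ht, by rw [hself]; linarith⟩
    · have hxZ : x ∈ Z := hx.resolve_right hxY
      rw [eZ x hxY] at ht
      rcases hφ (c₁ x) (e₁ x) with ⟨z', hz', y', hy', h1, h2, h3, h4, h5⟩ | ⟨h1, h2⟩
      · rw [h5] at ht
        refine ⟨y', hy', by rw [h3, cZ x hxY], by simpa using ht, ?_⟩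
        have := (hZ x hxZ z' hz' h1.symm).2 h2.symm
        have := htri x z' y'
        linarith
      · rw [h2] at ht
        simp at ht
  have hb' : ∀ x ∈ Z ∪ Y, ∀ t, e x = .inr t → x ∈ Z ∧ c x = c₁ x ∧ e₁ x = t := by
    intro x hx t ht
    by_cases hxY : x ∈ Y
    · rw [eY x hxY] at ht
      simp at ht
    · have hxZ : x ∈ Z := hx.resolve_right hxY
      rw [eZ x hxY] at ht
      rcases hφ (c₁ x) (e₁ x) with ⟨z', hz', y', hy', h1, h2, h3, h4, h5⟩ | ⟨h1, h2⟩
      · rw [h5] at ht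
        simp at ht
      · rw [h2] at ht
        exact ⟨hxZ, cZ x hxY, by simpa using ht⟩
  refine ⟨T₂ ⊕ T₁, c, e, max R (D + 2 * (R + r)), ?_⟩
  intro x hx y hy hc
  constructor
  · intro hd
    by_cases hxY : x ∈ Y <;> by_cases hyY : y ∈ Y
    · rw [eY x hxY, eY y hyY]
      rw [cY x hxY, cY y hyY] at hc
      congr 1
      exact (hY x hxY y hyY hc).1 (by linarith)
    · exact hYZ x hxY y (hy.resolve_right hyY) hyY hc hd
    · exact (hYZ y hyY x (hx.resolve_right hxY) hxY hc.symm (by rwa [hsymm])).symm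
    · rw [eZ x hxY, eZ y hyY]
      rw [cZ x hxY, cZ y hyY] at hc
      rw [hc, (hZ x (hx.resolve_right hxY) y (hy.resolve_right hyY) hc).1 hd]
  · intro he
    rcases hex : e x with t | t
    · obtain ⟨x', hx', h1, h2, h3⟩ := hb x hx t hex
      obtain ⟨y', hy', h1', h2', h3'⟩ := hb y hy t (by rw [← he, hex])
      have := (hY x' hx' y' hy' (by rw [h1, h1', hc])).2 (by rw [h2, h2'])
      have := htri x x' y
      have := htri x' y' y
      have := hsymm y' y
      apply le_max_of_le_right
      linarith
    · obtain ⟨hx', h1, h2⟩ := hb' x hx t hex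
      obtain ⟨hy', h1', h2'⟩ := hb' y hy t (by rw [← he, hex])
      exact le_max_of_le_left
        ((hZ x hx' y hy' (by rw [← h1, ← h1', hc])).2 (by rw [h2, h2']))

lemma AD.toAsdimLE {d : X → X → ℝ} {p : X → Prop} {n : ℕ} (h : AD d {x | p x} n) :
    AsdimLE (fun x y : {x // p x} => d x y) n := by
  intro r hr
  obtain ⟨T, c, e, D, hg⟩ := h r hr
  refine ⟨fun i => {U | ∃ t, U = {x : {x // p x} | c x = i ∧ e x = t}}, D, ?_, ?_, ?_⟩
  · rintro i _ ⟨t, rfl⟩ _ ⟨t', rfl⟩ hne x ⟨hx1, hx2⟩ y ⟨hy1, hy2⟩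
    by_contra! hd
    have := (hg x x.2 y y.2 (hx1.trans hy1.symm)).1 hd
    apply hne
    rw [← hx2, ← hy2, this]
  · rintro i _ ⟨t, rfl⟩ x ⟨hx1, hx2⟩ y ⟨hy1, hy2⟩
    exact (hg x x.2 y y.2 (hx1.trans hy1.symm)).2 (hx2.trans hy2.symm)
  · intro x
    exact ⟨c x, _, ⟨e x, rfl⟩, rfl, rfl⟩

end AD

section main

variable {G : Type u} [Group G]

lemma AD_sub {S S' : Set G} {A : Subgroup G} (hSS : S' ⊆ S) (hfin : S.Finite)
    (hS : ∀ s ∈ S, s⁻¹ ∈ S) (hS' : ∀ s ∈ S', s⁻¹ ∈ S') (hgen : Subgroup.closure S = ⊤)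
    (hgen' : Subgroup.closure S' = A) {n : ℕ}
    (hA : AsdimLE (fun a b : A => wordDist S' (↑a) (↑b)) n) :
    AD (wordDist S) (A : Set G) n := by
  classical
  intro r hr
  obtain ⟨M, hM⟩ := ((ball_finite hS hfin hgen ⌈r⌉₊).image (wordNorm S')).bddAbove
  obtain ⟨U, D, h1, h2, h3⟩ := hA (M + 1) (by positivity)
  choose c V hV hxV using h3
  refine ⟨Set A, fun g => if h : g ∈ A then c ⟨g, h⟩ else 0,
    fun g => if h : g ∈ A then V ⟨g, h⟩ else ∅, D, ?_⟩
  intro x hx y hy hc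
  have hx : x ∈ A := hx
  have hy : y ∈ A := hy
  simp only [hx, hy, dif_pos] at hc ⊢
  constructor
  · intro hd
    by_contra hne
    have := h1 _ _ (hV ⟨x, hx⟩) (V ⟨y, hy⟩) (by rw [hc]; exact hV _) hne _ (hxV _) _ (hxV _)
    simp only [wordDist] at this hd
    have hle : wordNorm S (x⁻¹ * y) ≤ ⌈r⌉₊ := by
      exact_mod_cast hd.le.trans (Nat.le_ceil r)
    have h4 : wordNorm S' (x⁻¹ * y) ≤ M := hM ⟨_, hle, rfl⟩
    have h5 : (wordNorm S' (x⁻¹ * y) : ℝ) ≤ M := by exact_mod_cast h4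
    linarith
  · intro he
    have := h2 _ _ (hV ⟨x, hx⟩) ⟨x, hx⟩ (hxV _) ⟨y, hy⟩ (by rw [he]; exact hxV _)
    refine le_trans ?_ this
    simp only [wordDist]
    obtain ⟨l, hl1, hl2, hl3⟩ := wordNorm_attained hS' (g := x⁻¹ * y)
      (by rw [hgen']; exact mul_mem (inv_mem hx) hy)
    rw [← hl1, ← hl3]
    exact_mod_cast wordNorm_le l (fun z hz => hSS (hl2 z hz))

/-- Elements of length at most `k`. -/
def L (F : Bool → Subgroup G) (C : Subgroup G) (k : ℕ) : Set G :=
  {g | ∃ j k', k' ≤ k ∧ W F C j k' g}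

variable {F : Bool → Subgroup G} {C : Subgroup G}

lemma Br.path (hC : ∀ i, C ≤ F i) {x i j n k g} (hx : W F C (!i) k x) (hg : Br F C x i j n g)
    (l : List G) (hl : ∀ s ∈ l, ∃ i, s ∈ F i)
    (hp : ∀ p, p <+: l → g * p.prod ∉ L F C k) : ∃ j n, Br F C x i j n (g * l.prod) := by
  induction l using List.reverseRecOn with
  | nil => exact ⟨j, n, by simpa using hg⟩
  | append_singleton l s ih =>
    obtain ⟨j', n', h⟩ := ih (fun s hs => hl s (by simp [hs]))
      (fun p hpl => hp p (hpl.trans (List.prefix_append _ _)))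
    obtain ⟨i', hs⟩ := hl s (by simp)
    have heq : g * (l ++ [s]).prod = g * l.prod * s := by simp [mul_assoc]
    rw [heq]
    rcases h.mulF hC hx hs with h | ⟨j', h⟩
    · exact h
    · exact (hp _ (List.prefix_refl _) (by rw [heq]; exact ⟨j', k, le_rfl, h⟩)).elim

lemma sep (hC : ∀ i, C ≤ F i)
    (huniq : ∀ {j k g j' k'}, W F C j k g → W F C j' k' g → k = k' ∧ (0 < k → j = j'))
    {j j' k g g'} (hg : W F C j (k + 1) g) (hg' : W F C j' (k + 1) g') (l : List G)
    (hl : ∀ s ∈ l, ∃ i, s ∈ F i) (hgl : g' = g * l.prod)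
    (hp : ∀ p, p <+: l → g * p.prod ∉ L F C k) : j = j' ∧ g⁻¹ * g' ∈ F j := by
  rcases hg with _ | ⟨j, _, x, s, hx, hs, hsC⟩
  have hx' : W F C (!(!j)) k x := by simpa using hx
  obtain ⟨j'', n, h⟩ := Br.path hC hx' (Br.one s hs hsC) l hl hp
  rw [← hgl] at h
  obtain ⟨h1, h2⟩ := huniq (h.toW hx') hg'
  have hn : n = 0 := by omega
  have hj := h2 (by omega)
  subst hn
  subst hj
  cases h with
  | one t ht htC =>
    refine ⟨rfl, ?_⟩
    rw [show (x * s)⁻¹ * (x * t) = s⁻¹ * t by group]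
    exact mul_mem (inv_mem hs) ht

lemma AD_L (hC : ∀ i, C ≤ F i)
    (huniq : ∀ {j k g j' k'}, W F C j k g → W F C j' k' g → k = k' ∧ (0 < k → j = j'))
    {S : Set G} (hS : ∀ s ∈ S, s⁻¹ ∈ S) (hgen : Subgroup.closure S = ⊤)
    (hSF : ∀ s ∈ S, ∃ i, s ∈ F i) {n : ℕ} (hF : ∀ i, AD (wordDist S) (F i : Set G) n) (k : ℕ) :
    AD (wordDist S) (L F C k) n := by
  induction k with
  | zero =>
    refine (hF true).mono ?_
    rintro g ⟨j, k', hk, h⟩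
    obtain rfl : k' = 0 := by omega
    cases h with
    | nil _ _ hc => exact hC _ hc
  | succ k ih =>
    classical
    intro r hr
    have hsymm := wordDist_comm hS hgen
    have htri := wordDist_triangle hS hgen
    have hN := ih.nbhd hsymm htri r hr
    set Y : Set G := {x | ∃ y ∈ L F C k, wordDist S x y < r} with hYdef
    choose T c e D hg using fun i => hF i r hr
    let ρ : Bool → G → G := fun j g => ((g : G ⧸ F j)).out
    have hρ : ∀ j g, (ρ j g)⁻¹ * g ∈ F j := by
      intro j g
      rw [← QuotientGroup.eq]
      exact QuotientGroup.out_eq' _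
    have hJ : ∀ g, ∃ j, (∃ j, W F C j (k + 1) g) → W F C j (k + 1) g := by
      intro g
      by_cases h : ∃ j, W F C j (k + 1) g
      · obtain ⟨j, hj⟩ := h
        exact ⟨j, fun _ => hj⟩
      · exact ⟨true, fun h' => (h h').elim⟩
    choose J hJ using hJ
    let lab : Bool → G → Σ j, (G ⧸ F j) × T j := fun j g => ⟨j, (g, e j ((ρ j g)⁻¹ * g))⟩
    have hZ : Good (wordDist S) (L F C (k + 1) \ Y) (fun g => c (J g) ((ρ (J g) g)⁻¹ * g))
        (fun g => lab (J g) g) r (max 0 (max (D true) (D false))) := by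
      have hW : ∀ g ∈ L F C (k + 1) \ Y, W F C (J g) (k + 1) g := by
        rintro g ⟨⟨j, k', hk', h⟩, hgY⟩
        apply hJ
        rcases Nat.lt_or_ge k' (k + 1) with hlt | hge
        · exact (hgY ⟨g, ⟨j, k', by omega, h⟩, by rw [wordDist_self]; exact hr⟩).elim
        · obtain rfl : k' = k + 1 := by omega
          exact ⟨j, h⟩
      intro x hx y hy hc
      have hWx := hW x hx
      have hWy := hW y hy
      simp only at hc ⊢
      generalize J x = jx at *
      generalize J y = jy at *
      constructor
      · intro hd
        obtain ⟨l, hl1, hl2, hl3⟩ := wordNorm_attained hS (g := x⁻¹ * y) (by simp [hgen])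
        obtain ⟨hj, hF⟩ := sep hC huniq hWx hWy l (fun s hs => hSF s (hl2 s hs))
          (by rw [hl3]; group) (by
            intro p hp hL
            apply hx.2
            refine ⟨_, hL, lt_of_le_of_lt ?_ hd⟩
            simp only [wordDist, inv_mul_cancel_left]
            rw [← hl1]
            exact_mod_cast (wordNorm_le p (fun z hz => hl2 z (hp.subset hz))).trans hp.length_le)
        subst hj
        have hq : (x : G ⧸ F jx) = y := QuotientGroup.eq.2 hF
        have hρe : ρ jx x = ρ jx y := by simp only [ρ, hq]
        have := (hg jx _ (hρ jx x) _ (hρ jx y) hc).1 (by rw [hρe, wordDist_left]; exact hd)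
        simp only [lab]
        rw [this, hq]
      · intro he
        obtain rfl : jx = jy := congrArg Sigma.fst he
        have he := eq_of_heq (Sigma.mk.inj he).2
        obtain ⟨hq, he⟩ := Prod.mk.inj he
        have hρe : ρ jx x = ρ jx y := by simp only [ρ, hq]
        have := (hg jx _ (hρ jx x) _ (hρ jx y) hc).2 he
        rw [hρe, wordDist_left] at this
        refine this.trans (le_max_of_le_right ?_)
        cases jx
        · exact le_max_right _ _
        · exact le_max_left _ _
    obtain ⟨T₂, c₂, e₂, D₂, hY⟩ := hN (max 0 (max (D true) (D false)) + 2 * r) (by positivity)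
    obtain ⟨T', c', e', D', h⟩ := union_good (wordDist_self S) hsymm htri hr (le_max_left _ _) hZ hY
    refine ⟨T', c', e', D', fun x hx y hy => h x ?_ y ?_⟩
    · by_cases hxY : x ∈ Y
      · exact .inr hxY
      · exact .inl ⟨hx, hxY⟩
    · by_cases hxY : y ∈ Y
      · exact .inr hxY
      · exact .inl ⟨hy, hxY⟩

lemma prod_mem_L (hC : ∀ i, C ≤ F i) (m : ℕ) (a b : Fin m → G) (ha : ∀ i, a i ∈ F true)
    (hb : ∀ i, b i ∈ F false) :
    (List.ofFn (fun i => a i * b i)).prod ∈ L F C (2 * m) := by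
  induction m with
  | zero => exact ⟨true, 0, by omega, by simpa using W.nil true 1 (one_mem _)⟩
  | succ m ih =>
    obtain ⟨j, k, hk, h⟩ := ih (fun i => a i.castSucc) (fun i => b i.castSucc)
      (fun i => ha _) (fun i => hb _)
    obtain ⟨j', k', hk', h'⟩ := h.mulF hC (ha (Fin.last m))
    obtain ⟨j'', k'', hk'', h''⟩ := h'.mulF hC (hb (Fin.last m))
    refine ⟨j'', k'', by omega, ?_⟩
    rw [List.ofFn_succ', List.concat_eq_append, List.prod_append, List.prod_singleton,
      ← mul_assoc]
    exact h''

end main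

end AsdimAB

/-- **Lemma 2.1.** Let `G = A *_C B`, with `asdim A ≤ n` and `asdim B ≤ n`
(each with its own word metric).  Then `asdim ((AB)^m) ≤ n` for every `m`,
where `(AB)^m = {a₁ b₁ a₂ b₂ ⋯ a_m b_m : aᵢ ∈ A, bᵢ ∈ B} ⊆ A *_C B` carries
the metric restricted from the word metric of `A *_C B`. -/
theorem asdimLE_prod_AB {G : Type*} [Group G] (A B C : Subgroup G)
    (hG : IsAmalgamatedProduct G A B C)
    (SA SB : Set G) (hSAfin : SA.Finite) (hSBfin : SB.Finite)
    (hSAsymm : ∀ s ∈ SA, s⁻¹ ∈ SA) (hSBsymm : ∀ s ∈ SB, s⁻¹ ∈ SB)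
    (hSAgen : Subgroup.closure SA = A) (hSBgen : Subgroup.closure SB = B)
    (n : ℕ)
    (hA : AsdimLE (fun a b : A => wordDist SA (↑a) (↑b)) n)
    (hB : AsdimLE (fun a b : B => wordDist SB (↑a) (↑b)) n)
    (m : ℕ) :
    AsdimLE (fun x y : {g : G // ∃ a b : Fin m → G,
        (∀ i, a i ∈ A) ∧ (∀ i, b i ∈ B) ∧
        g = (List.ofFn (fun i => a i * b i)).prod} =>
      wordDist (SA ∪ SB) (↑x) (↑y)) n := by
  have hC : ∀ i, C ≤ AsdimAB.fam A B i := by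
    intro i
    cases i
    · exact hG.2.1
    · exact hG.1
  have hcA : Countable A := by
    rw [← hSAgen]; exact AsdimAB.closure_countable hSAsymm hSAfin
  have hcB : Countable B := by
    rw [← hSBgen]; exact AsdimAB.closure_countable hSBsymm hSBfin
  obtain ⟨f, hf⟩ := AsdimAB.exists_hom A B C hG hC
  have hS : ∀ s ∈ SA ∪ SB, s⁻¹ ∈ SA ∪ SB := by
    rintro s (hs | hs)
    · exact .inl (hSAsymm s hs)
    · exact .inr (hSBsymm s hs)
  have hgen : Subgroup.closure (SA ∪ SB) = ⊤ := by
    rw [← hG.2.2.1, Subgroup.closure_union, Subgroup.closure_union, hSAgen, hSBgen,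
      Subgroup.closure_eq, Subgroup.closure_eq]
  have hfin : (SA ∪ SB).Finite := hSAfin.union hSBfin
  have hF : ∀ i, AsdimAB.AD (wordDist (SA ∪ SB)) (AsdimAB.fam A B i : Set G) n := by
    intro i
    cases i
    · exact AsdimAB.AD_sub Set.subset_union_right hfin hS hSBsymm hgen hSBgen hB
    · exact AsdimAB.AD_sub Set.subset_union_left hfin hS hSAsymm hgen hSAgen hA
  have hSF : ∀ s ∈ SA ∪ SB, ∃ i, s ∈ AsdimAB.fam A B i := by
    rintro s (hs | hs)
    · exact ⟨true, hSAgen ▸ Subgroup.subset_closure hs⟩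
    · exact ⟨false, hSBgen ▸ Subgroup.subset_closure hs⟩
  have hL := AsdimAB.AD_L hC (fun h h' => AsdimAB.W.unique hC f hf h h') hS hgen hSF hF (2 * m)
  refine AsdimAB.AD.toAsdimLE (hL.mono ?_)
  rintro g ⟨a, b, ha, hb, rfl⟩
  exact AsdimAB.prod_mem_L hC m a b ha hb
end
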